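/- arXiv:1007.0665 — 3 statements merged into one kernel-verified Lean document; each statement's English description precedes it below -/
import Mathlib

section
/- Let N/F be a Galois extension of number fields of odd degree. Then there exists a unique fractional ideal 𝒜 of 𝓞_N such that 𝒜² = 𝔇_{N/F}⁻¹, where 𝔇_{N/F} is the different ideal of N/F regarded as a (nonzero) fractional ideal of N. (𝒜 is called the square root of the inverse different.) -/
open NumberField
open scoped nonZeroDivisors

open Polynomial UniqueFactorizationMonoid
open scoped Pointwise

/-- If `x` generates the residue field at `P`, `x ^ q - x` is a uniformizer at `P`, and `x` lies in
every other prime above `P ∩ A`, then the conductor of `A[x]` is not contained in `P`. -/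
theorem exists_mem_conductor_notMem {A B : Type*} [CommRing A] [CommRing B] [IsDedekindDomain B]
    [Algebra A B] [Module.Finite A B] (P : Ideal B) [P.IsMaximal] (x : B) (q : ℕ) (hq : q ≠ 0)
    (hxP : x ∉ P)
    (hx : ∀ Q : Ideal B, Q.IsPrime → (P.comap (algebraMap A B)).map (algebraMap A B) ≤ Q →
      Q ≠ P → x ∈ Q)
    (h1 : x ^ (q + 1) - x ∈ P) (h2 : x ^ (q + 1) - x ∉ P ^ 2)
    (hres : ∀ b : B, ∃ c ∈ Algebra.adjoin A {x}, b - c ∈ P) :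
    ∃ s ∈ conductor A x, s ∉ P := by
  set C := Algebra.adjoin A {x} with hC
  have hxC : x ∈ C := Algebra.subset_adjoin rfl
  set 𝔮 : Ideal C := P.comap (algebraMap C B) with h𝔮
  set I : Ideal B := 𝔮.map (algebraMap C B) with hI
  have hIP : I ≤ P := Ideal.map_comap_le
  have memI : ∀ c ∈ C, c ∈ P → c ∈ I := fun c hc hcP =>
    Ideal.mem_map_of_mem (algebraMap C B) (x := ⟨c, hc⟩) hcP
  have hIeq : I = P := by
    obtain ⟨K, hK⟩ := Ideal.dvd_iff_le.2 hIP
    suffices K = ⊤ by rw [hK, this, Ideal.mul_top]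
    by_contra hKtop
    obtain ⟨Q, hQ, hKQ⟩ := Ideal.exists_le_maximal K hKtop
    by_cases hQP : Q = P
    · refine h2 ?_
      have : I ≤ P ^ 2 := by
        rw [hK, sq]; exact Ideal.mul_mono_right (hQP ▸ hKQ)
      exact this (memI _ (sub_mem (pow_mem hxC _) hxC) h1)
    · have hIQ : I ≤ Q := by rw [hK]; exact Ideal.mul_le_right.trans hKQ
      have hxQ : x ∈ Q := by
        refine hx Q hQ.isPrime (Ideal.map_le_iff_le_comap.2 fun a ha => ?_) hQP
        exact hIQ (memI _ (C.algebraMap_mem a) ha)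
      have h3 : x ^ q - 1 ∈ P := by
        have : x * (x ^ q - 1) ∈ P := by convert h1 using 1; ring
        exact ((Ideal.IsMaximal.isPrime ‹_›).mem_or_mem this).resolve_left hxP
      have h4 : x ^ q - 1 ∈ Q := hIQ (memI _ (sub_mem (pow_mem hxC _) (one_mem _)) h3)
      refine hQ.ne_top ((Ideal.eq_top_iff_one _).2 ?_)
      have := sub_mem (Q.pow_mem_of_mem hxQ q (Nat.pos_of_ne_zero hq)) h4
      simpa using this
  have : Module.Finite C B := Module.Finite.of_restrictScalars_finite A C B
  let R : Submodule C B := LinearMap.range (Algebra.linearMap C B)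
  obtain ⟨r, hr1, hr⟩ := Submodule.exists_sub_one_mem_and_smul_eq_zero_of_fg_of_le_smul 𝔮
    (⊤ : Submodule C (B ⧸ R)) Module.Finite.fg_top (by
      rintro z -
      obtain ⟨b, rfl⟩ := Submodule.Quotient.mk_surjective R z
      obtain ⟨c, hc, hbc⟩ := hres b
      have hbc' : b - c ∈ (𝔮 • ⊤ : Submodule C B) := by
        rw [← hIeq] at hbc
        rw [Ideal.smul_top_eq_map]
        exact hbc
      have h5 : (Submodule.Quotient.mk b : B ⧸ R) = R.mkQ (b - c) := by
        rw [map_sub, Submodule.mkQ_apply, Submodule.mkQ_apply,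
          (Submodule.Quotient.mk_eq_zero R (x := c)).2 ⟨⟨c, hc⟩, rfl⟩, sub_zero]
      rw [h5]
      have h6 := Submodule.mem_map_of_mem (f := R.mkQ) hbc'
      rw [Submodule.map_smul''] at h6
      exact Submodule.smul_mono le_rfl le_top h6)
  refine ⟨r, fun b => ?_, fun hrP => ?_⟩
  · have := hr (Submodule.Quotient.mk b) trivial
    rw [← Submodule.Quotient.mk_smul, Submodule.Quotient.mk_eq_zero] at this
    obtain ⟨c, hc⟩ := this
    have h7 : (r : B) * b = c := hc.symm
    rw [h7]
    exact c.2
  · have h8 : (r : B) - 1 ∈ P := hr1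
    refine Ideal.IsMaximal.ne_top ‹P.IsMaximal› ((Ideal.eq_top_iff_one _).2 ?_)
    simpa using sub_mem hrP h8

/-- A lift of a generator of the unit group of the finite residue field at `P` can be chosen so that
`x ^ q - x` is a uniformizer at `P`. -/
theorem exists_residue_generator {B : Type*} [CommRing B] [IsDedekindDomain B]
    (P : Ideal B) [hP : P.IsMaximal] (hP0 : P ≠ ⊥) [Finite (B ⧸ P)] :
    ∃ (x : B) (q : ℕ), q ≠ 0 ∧ x ∉ P ∧ x ^ (q + 1) - x ∈ P ∧ x ^ (q + 1) - x ∉ P ^ 2 ∧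
      ∀ b ∉ P, ∃ n : ℕ, b - x ^ n ∈ P := by
  let _ : Field (B ⧸ P) := Ideal.Quotient.field P
  let _ : Fintype (B ⧸ P) := Fintype.ofFinite _
  obtain ⟨g, hg⟩ := IsCyclic.exists_monoid_generator (α := (B ⧸ P)ˣ)
  obtain ⟨q, hq⟩ : ∃ q, Fintype.card (B ⧸ P) = q + 1 :=
    Nat.exists_eq_succ_of_ne_zero Fintype.card_ne_zero
  have hq0 : q ≠ 0 := by
    have := Fintype.one_lt_card (α := B ⧸ P)
    omega
  have key : ∀ y : B, Ideal.Quotient.mk P y = g → y ∉ P ∧ y ^ (q + 1) - y ∈ P ∧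
      ∀ b ∉ P, ∃ n : ℕ, b - y ^ n ∈ P := by
    intro y hy
    refine ⟨fun h => g.ne_zero ?_, ?_, fun b hb => ?_⟩
    · rw [← hy]; exact Ideal.Quotient.eq_zero_iff_mem.2 h
    · rw [← Ideal.Quotient.eq, map_pow, ← hq, FiniteField.pow_card]
    · have hb' : Ideal.Quotient.mk P b ≠ 0 := fun h => hb (Ideal.Quotient.eq_zero_iff_mem.1 h)
      obtain ⟨n, hn⟩ := hg (Units.mk0 _ hb')
      refine ⟨n, ?_⟩
      rw [← Ideal.Quotient.eq, map_pow, hy]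
      simpa using (congrArg Units.val hn).symm
  obtain ⟨y, hy⟩ := Ideal.Quotient.mk_surjective (g : B ⧸ P)
  by_cases h : y ^ (q + 1) - y ∈ P ^ 2
  · obtain ⟨t, ht1, ht2⟩ := P.exists_mem_pow_notMem_pow_succ hP0 hP.ne_top 1
    rw [pow_one] at ht1
    have hyt : Ideal.Quotient.mk P (y + t) = g := by
      rw [map_add, hy, Ideal.Quotient.eq_zero_iff_mem.2 ht1, add_zero]
    obtain ⟨k1, k2, k3⟩ := key _ hyt
    refine ⟨y + t, q, hq0, k1, k2, fun hmem => ht2 ?_, k3⟩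
    obtain ⟨k, hk⟩ := (X ^ (q + 1) : B[X]).binomExpansion y t
    simp only [eval_pow, eval_X, derivative_X_pow, eval_mul, eval_C] at hk
    have hqP : ((q + 1 : ℕ) : B) ∈ P := by
      rw [← Ideal.Quotient.eq_zero_iff_mem, map_natCast, ← hq, Nat.cast_card_eq_zero]
    have e : t = (y ^ (q + 1) - y) + (((q + 1 : ℕ) : B) * t) * y ^ q + k * t ^ 2
        - ((y + t) ^ (q + 1) - (y + t)) := by
      rw [hk]; simp only [Nat.add_sub_cancel]; ring
    change t ∈ P ^ 2
    rw [e]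
    refine sub_mem (add_mem (add_mem h (Ideal.mul_mem_right _ _ ?_)) (Ideal.mul_mem_left _ _ ?_))
      hmem
    · rw [sq]; exact Ideal.mul_mem_mul hqP ht1
    · exact Ideal.pow_mem_pow ht1 2
  · obtain ⟨k1, k2, k3⟩ := key _ hy
    exact ⟨y, q, hq0, k1, k2, h, k3⟩

/-- An element prime to `P`, lying in all other primes above `P ∩ A`, and generating an order
whose conductor is prime to `P`. -/
theorem exists_conductor_prime_to {A B : Type*} [CommRing A] [CommRing B] [IsDedekindDomain B]
    [Algebra A B] [Module.Finite A B] (P : Ideal B) [hP : P.IsMaximal]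
    (hP0 : (P.comap (algebraMap A B)).map (algebraMap A B) ≠ ⊥) [Finite (B ⧸ P)] :
    ∃ x : B, x ∉ P ∧ (∀ Q : Ideal B, Q.IsPrime →
        (P.comap (algebraMap A B)).map (algebraMap A B) ≤ Q → Q ≠ P → x ∈ Q) ∧
      ∃ s ∈ conductor A x, s ∉ P := by
  have hPbot : P ≠ ⊥ := fun h => hP0 (le_bot_iff.1 (h ▸ Ideal.map_comap_le))
  have hPprime : Prime P := Ideal.prime_of_isPrime hPbot hP.isPrime
  obtain ⟨y, q, hq0, hyP, hy1, hy2, hy3⟩ := exists_residue_generator P hPbot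
  obtain ⟨J, hJ, hPJ⟩ :=
    (FiniteMultiplicity.of_prime_left hPprime hP0).exists_eq_pow_mul_and_not_dvd
  have hcop : IsCoprime (P ^ 2) J := by
    refine IsCoprime.pow_left ?_
    rw [Ideal.isCoprime_iff_sup_eq]
    by_contra h
    exact hPJ (Ideal.dvd_iff_le.2 ((hP.eq_of_le h le_sup_left).symm ▸ le_sup_right))
  obtain ⟨a, ha, b, hb, hab⟩ := Ideal.isCoprime_iff_exists.1 hcop
  have hxy : y * b - y ∈ P ^ 2 := by
    have : y * b - y = -(y * a) := by linear_combination y * hab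
    rw [this]
    exact neg_mem (Ideal.mul_mem_left _ _ ha)
  have hxy1 : y * b - y ∈ P := Ideal.pow_le_self two_ne_zero hxy
  have hpow : ∀ (K : Ideal B) (n : ℕ), y * b - y ∈ K → (y * b) ^ n - y ^ n ∈ K := fun K n h => by
    rw [← Ideal.Quotient.eq] at h ⊢
    rw [map_pow, map_pow, h]
  have hcong : ∀ K : Ideal B, y * b - y ∈ K →
      ((y * b) ^ (q + 1) - y * b ∈ K ↔ y ^ (q + 1) - y ∈ K) := fun K h => by
    rw [← Ideal.Quotient.eq] at h
    rw [← Ideal.Quotient.eq, ← Ideal.Quotient.eq, map_pow, map_pow, h]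
  have hxP : y * b ∉ P := fun h => hyP (by simpa using sub_mem h hxy1)
  have hQ : ∀ Q : Ideal B, Q.IsPrime →
        (P.comap (algebraMap A B)).map (algebraMap A B) ≤ Q → Q ≠ P → y * b ∈ Q := by
    intro Q hQ hle hne
    rw [hJ] at hle
    rcases hQ.mul_le.1 hle with h | h
    · exact absurd (hP.eq_of_le hQ.ne_top (hQ.le_of_pow_le h)).symm hne
    · exact Q.mul_mem_left _ (h hb)
  refine ⟨y * b, hxP, hQ, exists_mem_conductor_notMem P _ q hq0 hxP hQ ((hcong P hxy1).2 hy1)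
    (fun h => hy2 ((hcong _ hxy).1 h)) fun c => ?_⟩
  by_cases hc : c ∈ P
  · exact ⟨0, zero_mem _, by simpa using hc⟩
  · obtain ⟨n, hn⟩ := hy3 c hc
    refine ⟨(y * b) ^ n, pow_mem (Algebra.self_mem_adjoin_singleton A (y * b)) n, ?_⟩
    have := sub_mem hn (hpow P n hxy1)
    rwa [sub_sub_sub_cancel_right] at this

/-- If the order `A[x]` has nonzero conductor, then `x` is a primitive element. -/
theorem adjoin_eq_top_of_mem_conductor {A B : Type*} (K L : Type*) [CommRing A] [CommRing B]
    [Field K] [Field L] [IsDomain B]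
    [Algebra A B] [Algebra A K] [Algebra K L] [Algebra A L] [Algebra B L] [IsScalarTower A B L]
    [IsScalarTower A K L] [IsFractionRing B L] [FiniteDimensional K L]
    {x s : B} (hs : s ∈ conductor A x) (hs0 : s ≠ 0) :
    Algebra.adjoin K {algebraMap B L x} = ⊤ := by
  rw [← IntermediateField.adjoin_simple_toSubalgebra_of_isAlgebraic
    (Algebra.IsAlgebraic.isAlgebraic _), ← IntermediateField.top_toSubalgebra]
  congr 1
  rw [eq_top_iff]
  rintro z -
  have key : ∀ c ∈ Algebra.adjoin A {x}, algebraMap B L c ∈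
      IntermediateField.adjoin K {algebraMap B L x} := by
    intro c hc
    induction hc using Algebra.adjoin_induction with
    | mem y hy =>
      rw [Set.mem_singleton_iff.1 hy]
      exact IntermediateField.mem_adjoin_simple_self K _
    | algebraMap r =>
      rw [← IsScalarTower.algebraMap_apply A B L, IsScalarTower.algebraMap_apply A K L]
      exact algebraMap_mem _ _
    | add a b _ _ ha hb => rw [map_add]; exact add_mem ha hb
    | mul a b _ _ ha hb => rw [map_mul]; exact mul_mem ha hb
  obtain ⟨b, c, hc, rfl⟩ := IsFractionRing.div_surjective (A := B) z
  have hs' : algebraMap B L s ≠ 0 := by simpa using hs0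
  rw [← mul_div_mul_left _ _ hs', ← map_mul, ← map_mul]
  exact div_mem (key _ (hs b)) (key _ (hs c))

/-- The different of a primitive element of a Galois extension. -/
theorem aeval_derivative_minpoly_eq_prod {K L : Type*} [Field K] [Field L] [Algebra K L]
    [FiniteDimensional K L] [IsGalois K L] [DecidableEq Gal(L/K)] {x : L}
    (hx : Algebra.adjoin K {x} = ⊤) :
    aeval x (derivative (minpoly K x)) = ∏ σ ∈ Finset.univ.erase (1 : Gal(L/K)), (x - σ x) := by
  classical
  have hint : IsIntegral K x := Algebra.IsIntegral.isIntegral x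
  have htop : IntermediateField.adjoin K {x} = ⊤ := by
    apply IntermediateField.toSubalgebra_injective
    rw [IntermediateField.adjoin_simple_toSubalgebra_of_isAlgebraic hint.isAlgebraic, hx,
      IntermediateField.top_toSubalgebra]
  have hinj : Function.Injective fun σ : Gal(L/K) => σ x := by
    intro σ τ h
    have : (σ : L →ₐ[K] L) = τ := AlgHom.ext_of_adjoin_eq_top hx (by simpa using h)
    ext z
    exact DFunLike.congr_fun this z
  have hmin : (minpoly K x).map (algebraMap K L) = ∏ σ : Gal(L/K), (X - C (σ x)) := by
    symm
    refine Polynomial.eq_of_dvd_of_natDegree_le_of_leadingCoeff ?_ ?_ ?_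
    · refine Finset.prod_dvd_of_coprime (fun σ _ τ _ h => ?_) fun σ _ => ?_
      · exact isCoprime_X_sub_C_of_isUnit_sub
          (sub_ne_zero.2 fun e => h (hinj e)).isUnit
      · rw [dvd_iff_isRoot, IsRoot, eval_map_algebraMap, aeval_algHom_apply, minpoly.aeval, map_zero]
    · rw [natDegree_map, natDegree_prod_of_monic _ _ fun _ _ => monic_X_sub_C _]
      simp only [natDegree_X_sub_C, Finset.sum_const, smul_eq_mul, mul_one, Finset.card_univ]
      rw [← IntermediateField.adjoin.finrank hint, htop, IntermediateField.finrank_top',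
        ← Nat.card_eq_fintype_card, IsGalois.card_aut_eq_finrank]
    · rw [((minpoly.monic hint).map _).leadingCoeff,
        (monic_prod_of_monic _ _ fun _ _ => monic_X_sub_C _).leadingCoeff]
  rw [← eval_map_algebraMap, ← derivative_map, hmin,
    ← Finset.mul_prod_erase Finset.univ _ (Finset.mem_univ (1 : Gal(L/K))), derivative_mul]
  simp [eval_prod]

/-- In a finite group of odd order, a function invariant under inversion has even sum over the
nontrivial elements. -/
theorem even_sum_erase_one {G : Type*} [Group G] [Fintype G] [DecidableEq G]
    (hodd : Odd (Nat.card G)) (h : G → ℕ) (hh : ∀ σ, h σ⁻¹ = h σ) :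
    Even (∑ σ ∈ Finset.univ.erase (1 : G), h σ) := by
  rw [← ZMod.natCast_eq_zero_iff_even, Nat.cast_sum]
  refine Finset.sum_involution (fun σ _ => σ⁻¹) (fun σ _ => ?_) (fun σ hσ _ e => ?_)
    (fun σ hσ => ?_) (fun σ _ => inv_inv σ)
  · rw [hh]; exact CharTwo.add_self_eq_zero _
  · refine (Finset.ne_of_mem_erase hσ) ?_
    have h2 : orderOf σ ∣ 2 := orderOf_dvd_of_pow_eq_one (by
      rw [sq]; nth_rewrite 1 [← e]; exact inv_mul_cancel σ)
    have h3 : orderOf σ ∣ Nat.card G := orderOf_dvd_natCard σ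
    rw [← orderOf_eq_one_iff]
    exact Nat.eq_one_of_dvd_coprimes (Nat.coprime_two_left.2 hodd) h2 h3
  · simpa using hσ

/-- Automorphisms stabilizing `P` preserve the multiplicity of `P`. -/
theorem emultiplicity_span_smul {G B : Type*} [Group G] [CommRing B] [IsDedekindDomain B]
    [MulSemiringAction G B] {P : Ideal B} {σ : G} (hσ : σ • P = P) (b : B) :
    emultiplicity P (Ideal.span {σ • b}) = emultiplicity P (Ideal.span {b}) := by
  rw [emultiplicity_eq_emultiplicity_iff]
  intro n
  rw [Ideal.dvd_span_singleton, Ideal.dvd_span_singleton]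
  have : σ • P ^ n = P ^ n := by rw [smul_pow', hσ]
  nth_rewrite 1 [← this]
  exact Ideal.smul_mem_pointwise_smul_iff

/-- A nonzero ideal of a Dedekind domain divisible an even number of times by each prime is a
square. -/
theorem isSquare_of_even_emultiplicity {B : Type*} [CommRing B] [IsDedekindDomain B]
    {I : Ideal B} (hI : I ≠ ⊥) (h : ∀ P : Ideal B, P.IsPrime → P ≠ ⊥ → Even (multiplicity P I)) :
    ∃ J : Ideal B, J ^ 2 = I := by
  classical
  refine ⟨∏ P ∈ (normalizedFactors I).toFinset, P ^ (multiplicity P I / 2), ?_⟩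
  rw [← Finset.prod_pow]
  conv_rhs => rw [← Ideal.prod_normalizedFactors_eq_self hI, Finset.prod_multiset_count]
  refine Finset.prod_congr rfl fun P hP => ?_
  have hP' := prime_of_normalized_factor P (Multiset.mem_toFinset.1 hP)
  rw [← pow_mul, Nat.div_mul_cancel (h P (Ideal.isPrime_of_prime hP') hP'.ne_zero).two_dvd,
    multiplicity_eq_of_emultiplicity_eq_some
      (emultiplicity_eq_count_normalizedFactors hP'.irreducible hI), normalize_eq]

/-- Squaring is injective on the nonzero fractional ideals of a Dedekind domain. -/
theorem FractionalIdeal.eq_of_sq_eq_sq {B L : Type*} [CommRing B] [IsDedekindDomain B] [Field L]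
    [Algebra B L] [IsFractionRing B L] {I J : FractionalIdeal B⁰ L} (hI : I ≠ 0) (hJ : J ≠ 0)
    (h : I ^ 2 = J ^ 2) : I = J := by
  rw [← FractionalIdeal.finprod_heightOneSpectrum_factorization' L hI,
    ← FractionalIdeal.finprod_heightOneSpectrum_factorization' L hJ]
  refine finprod_congr fun v => ?_
  have := congrArg (FractionalIdeal.count L v) h
  rw [FractionalIdeal.count_pow, FractionalIdeal.count_pow] at this
  congr 1
  simpa using this

/-- In a Galois extension of number fields of odd degree, every prime divides the different an even
number of times. -/
theorem even_multiplicity_differentIdeal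
    (F N : Type*) [Field F] [Field N] [NumberField F] [NumberField N]
    [Algebra F N] [IsGalois F N] (hodd : Odd (Module.finrank F N))
    (P : Ideal (𝓞 N)) (hP : P.IsPrime) (hP0 : P ≠ ⊥) :
    Even (multiplicity P (differentIdeal (𝓞 F) (𝓞 N))) := by
  classical
  have hPmax : P.IsMaximal := hP.isMaximal hP0
  have hPprime : Prime P := Ideal.prime_of_isPrime hP0 hP
  set p := P.comap (algebraMap (𝓞 F) (𝓞 N)) with hp
  have hp0 : p.map (algebraMap (𝓞 F) (𝓞 N)) ≠ ⊥ := by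
    rw [Ne, Ideal.map_eq_bot_iff_of_injective (FaithfulSMul.algebraMap_injective _ _)]
    exact Ideal.IsIntegral.comap_ne_bot (𝓞 F) hP0
  obtain ⟨x, hxP, hxQ, s, hs, hsP⟩ := exists_conductor_prime_to (A := 𝓞 F) P hp0
  have hs0 : s ≠ 0 := fun h => hsP (h ▸ zero_mem _)
  have hgen := adjoin_eq_top_of_mem_conductor F N hs hs0
  have hprod : aeval x (derivative (minpoly (𝓞 F) x)) =
      ∏ σ ∈ Finset.univ.erase (1 : Gal(N/F)), (x - σ • x) := by
    apply FaithfulSMul.algebraMap_injective (𝓞 N) N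
    rw [← aeval_algebraMap_apply, map_prod]
    have := aeval_derivative_minpoly_eq_prod hgen
    rw [minpoly.isIntegrallyClosed_eq_field_fractions F N
      (Algebra.IsIntegral.isIntegral (R := 𝓞 F) x), derivative_map, aeval_map_algebraMap] at this
    rw [this]
    rfl
  have hcond : emultiplicity P (conductor (𝓞 F) x) = 0 :=
    emultiplicity_eq_zero.2 fun h => hsP (Ideal.dvd_iff_le.1 h hs)
  have hideal : ∏ σ ∈ Finset.univ.erase (1 : Gal(N/F)), Ideal.span {x - σ • x} =
      conductor (𝓞 F) x * differentIdeal (𝓞 F) (𝓞 N) := by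
    rw [Ideal.prod_span_singleton, ← hprod, ← conductor_mul_differentIdeal (𝓞 F) F N x hgen]
  have hD : emultiplicity P (differentIdeal (𝓞 F) (𝓞 N)) =
      ∑ σ ∈ Finset.univ.erase (1 : Gal(N/F)), emultiplicity P (Ideal.span {x - σ • x}) := by
    rw [← Finset.emultiplicity_prod hPprime, hideal, emultiplicity_mul hPprime, hcond, zero_add]
  have hne : ∀ σ ∈ Finset.univ.erase (1 : Gal(N/F)), Ideal.span {x - σ • x} ≠ 0 := by
    rw [← Finset.prod_ne_zero_iff, hideal]
    exact mul_ne_zero (fun h => hs0 (by simpa [h] using hs)) differentIdeal_ne_bot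
  have hinv : ∀ σ : Gal(N/F), multiplicity P (Ideal.span {x - σ⁻¹ • x}) =
      multiplicity P (Ideal.span {x - σ • x}) := by
    have hout : ∀ σ : Gal(N/F), σ • P ≠ P →
        emultiplicity P (Ideal.span {x - σ • x}) = 0 := by
      intro σ hσ
      rw [emultiplicity_eq_zero, Ideal.dvd_span_singleton]
      intro h
      have hσx : σ • x ∈ P := by
        rw [← Ideal.mem_inv_pointwise_smul_iff]
        refine hxQ _ inferInstance (Ideal.map_le_iff_le_comap.2 fun a ha => ?_) fun e => hσ ?_
        · rw [Ideal.mem_comap, Ideal.mem_inv_pointwise_smul_iff, smul_algebraMap]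
          exact ha
        · rw [← eq_inv_smul_iff, e]
      exact hxP (by simpa using add_mem h hσx)
    intro σ
    apply multiplicity_eq_of_emultiplicity_eq
    by_cases hσ : σ • P = P
    · have hσ' : σ⁻¹ • P = P := by rw [inv_smul_eq_iff, hσ]
      rw [← emultiplicity_span_smul hσ' (x - σ • x), smul_sub, inv_smul_smul,
        ← Ideal.span_singleton_neg, neg_sub]
    · have hσ' : σ⁻¹ • P ≠ P := fun e => hσ (by rw [← eq_inv_smul_iff, e])
      rw [hout _ hσ, hout _ hσ']
  have hcast : emultiplicity P (differentIdeal (𝓞 F) (𝓞 N)) =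
      ((∑ σ ∈ Finset.univ.erase (1 : Gal(N/F)), multiplicity P (Ideal.span {x - σ • x}) : ℕ) :
        ℕ∞) := by
    rw [hD, Nat.cast_sum]
    exact Finset.sum_congr rfl fun σ hσ =>
      (FiniteMultiplicity.of_prime_left hPprime (hne σ hσ)).emultiplicity_eq_multiplicity
  rw [multiplicity_eq_of_emultiplicity_eq_some hcast]
  exact even_sum_erase_one (by rwa [IsGalois.card_aut_eq_finrank]) _ hinv

/-- **Square root of the inverse different.**
For an odd degree Galois extension `N/F` of number fields, there is a unique
fractional ideal `𝒜` of `𝓞 N` whose square is the inverse of the different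
ideal of `N/F` (viewed as a fractional ideal of `N`). -/
theorem exists_unique_sqrt_inverse_different
    (F N : Type*) [Field F] [Field N] [NumberField F] [NumberField N]
    [Algebra F N] [IsGalois F N] (hodd : Odd (Module.finrank F N)) :
    ∃! 𝒜 : FractionalIdeal (𝓞 N)⁰ N,
      𝒜 ^ 2 = ((differentIdeal (𝓞 F) (𝓞 N) : Ideal (𝓞 N)) :
        FractionalIdeal (𝓞 N)⁰ N)⁻¹ := by
  have hD : differentIdeal (𝓞 F) (𝓞 N) ≠ ⊥ := differentIdeal_ne_bot
  obtain ⟨J, hJ⟩ := isSquare_of_even_emultiplicity hD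
    (even_multiplicity_differentIdeal F N hodd)
  have hne : ((differentIdeal (𝓞 F) (𝓞 N) : Ideal (𝓞 N)) : FractionalIdeal (𝓞 N)⁰ N)⁻¹ ≠ 0 :=
    inv_ne_zero (FractionalIdeal.coeIdeal_ne_zero.2 hD)
  have hsq : ∀ {𝒜 : FractionalIdeal (𝓞 N)⁰ N},
      𝒜 ^ 2 = ((differentIdeal (𝓞 F) (𝓞 N) : Ideal (𝓞 N)) : FractionalIdeal (𝓞 N)⁰ N)⁻¹ →
        𝒜 ≠ 0 := by
    rintro _ h rfl
    exact hne (by rw [← h, zero_pow two_ne_zero])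
  have hJ' : ((J : FractionalIdeal (𝓞 N)⁰ N)⁻¹) ^ 2 =
      ((differentIdeal (𝓞 F) (𝓞 N) : Ideal (𝓞 N)) : FractionalIdeal (𝓞 N)⁰ N)⁻¹ := by
    rw [inv_pow, ← FractionalIdeal.coeIdeal_pow, hJ]
  exact ⟨_, hJ', fun ℬ hℬ => FractionalIdeal.eq_of_sq_eq_sq (hsq hℬ) (hsq hJ') (hℬ.trans hJ'.symm)⟩
end

section
/- For every a ∈ L with ‖a‖ < p^{(p−1)/p²}, the series Σ_{n≥0} e_n aⁿ converges, i.e. the family (e_n aⁿ)_{n≥0} is summable in L. In particular Dwork's power series E_γ converges on the closed unit disc {a ∈ L : ‖a‖ ≤ 1}. -/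
/-- The `n`-th coefficient `e n` of Dwork's exponential power series
`E_γ(X) = exp(γ X − γ X^p) = Σ_{n ≥ 0} e_n X^n`, the formal power series obtained by
substituting the constant-term-zero series `γ X − γ X^p` into
`exp(X) = Σ_{n ≥ 0} X^n / n!`.  Expanding `exp(γ X) · exp(−γ X^p)` gives the explicit
convolution formula `e_n = Σ_{i + p·j = n} (γ^i / i!) · ((−γ)^j / j!)`. -/
noncomputable def dworkCoeff (L : Type*) [Field L] (p : ℕ) (γ : L) (n : ℕ) : L :=
  ∑ j ∈ Finset.range (n / p + 1),
    (γ ^ (n - p * j) / ((n - p * j).factorial : L)) * ((-γ) ^ j / (j.factorial : L))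

section PowerSeries

open PowerSeries

/-- A power series over a field of characteristic zero is determined by its constant coefficient
and its logarithmic derivative. -/
theorem PowerSeries.eq_of_derivative_eq_mul {K : Type*} [Field K] [CharZero K] {f g s : K⟦X⟧}
    (hf : d⁄dX K f = s * f) (hg : d⁄dX K g = s * g)
    (h0 : constantCoeff f = constantCoeff g) : f = g := by
  ext n
  induction n using Nat.strong_induction_on with
  | _ n ih =>
    cases n with
    | zero => simpa using h0
    | succ n =>
      have hf' := congrArg (coeff n) hf
      have hg' := congrArg (coeff n) hg
      rw [coeff_derivative, coeff_mul] at hf' hg'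
      have hs : ∑ x ∈ Finset.HasAntidiagonal.antidiagonal n, coeff x.1 s * coeff x.2 f =
          ∑ x ∈ Finset.HasAntidiagonal.antidiagonal n, coeff x.1 s * coeff x.2 g := by
        refine Finset.sum_congr rfl fun x hx => ?_
        rw [ih x.2 (by have := Finset.HasAntidiagonal.mem_antidiagonal.1 hx; omega)]
      have hn : (n + 1 : K) ≠ 0 := by exact_mod_cast n.succ_ne_zero
      exact mul_right_cancel₀ hn (hf'.trans (hs.trans hg'.symm))

theorem PowerSeries.constantCoeff_exp_subst {K : Type*} [Field K] [CharZero K] {f : K⟦X⟧}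
    (hf : constantCoeff f = 0) : constantCoeff ((exp K).subst f) = 1 := by
  rw [← coeff_zero_eq_constantCoeff_apply, coeff_subst' (HasSubst.of_constantCoeff_zero' hf),
    finsum_eq_single _ 0]
  · simp
  · intro n hn
    simp [hf, hn]

theorem PowerSeries.exp_subst_add {K : Type*} [Field K] [CharZero K] {f g : K⟦X⟧}
    (hf : constantCoeff f = 0) (hg : constantCoeff g = 0) :
    (exp K).subst (f + g) = (exp K).subst f * (exp K).subst g := by
  have key {h : K⟦X⟧} (hh : constantCoeff h = 0) :
      d⁄dX K ((exp K).subst h) = d⁄dX K h * (exp K).subst h := by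
    rw [derivative_subst (HasSubst.of_constantCoeff_zero' hh), derivative_exp, mul_comm]
  have hfg : constantCoeff (f + g) = 0 := by simp [hf, hg]
  refine eq_of_derivative_eq_mul (key hfg) ?_ ?_
  · rw [Derivation.leibniz, key hf, key hg, map_add]
    simp only [smul_eq_mul]
    ring
  · rw [map_mul, constantCoeff_exp_subst hf, constantCoeff_exp_subst hg,
      constantCoeff_exp_subst hfg, one_mul]

theorem PowerSeries.exp_subst_nsmul {K : Type*} [Field K] [CharZero K] {f : K⟦X⟧}
    (hf : constantCoeff f = 0) (n : ℕ) :
    (exp K).subst (n • f) = (exp K).subst f ^ n := by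
  induction n with
  | zero =>
    rw [zero_smul, pow_zero, subst_zero_eq_C_constantCoeff, constantCoeff_exp]
    simp
  | succ n ih => rw [succ_nsmul, exp_subst_add (by simp [hf]) hf, ih, pow_succ]

theorem PowerSeries.rescale_exp_subst {K : Type*} [Field K] [CharZero K] {f : K⟦X⟧}
    (hf : constantCoeff f = 0) (c : K) :
    rescale c ((exp K).subst f) = (exp K).subst (rescale c f) := by
  rw [rescale_eq_subst, rescale_eq_subst,
    subst_comp_subst_apply (HasSubst.of_constantCoeff_zero' hf) (HasSubst.smul_X' c)]

theorem PowerSeries.expand_exp_subst {K : Type*} [Field K] [CharZero K] {f : K⟦X⟧}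
    (hf : constantCoeff f = 0) {p : ℕ} (hp : p ≠ 0) :
    expand p hp ((exp K).subst f) = (exp K).subst (expand p hp f) := by
  rw [expand_apply, expand_apply,
    subst_comp_subst_apply (HasSubst.of_constantCoeff_zero' hf) (HasSubst.X_pow hp)]

theorem PowerSeries.exp_subst_C_mul_X {K : Type*} [Field K] [CharZero K] (c : K) :
    (exp K).subst (C c * X : K⟦X⟧) = rescale c (exp K) := by
  rw [rescale_eq_subst, ← smul_eq_C_mul]

theorem coeff_exp_subst_eq_dworkCoeff {K : Type*} [Field K] [CharZero K] {p : ℕ} (hp : p ≠ 0)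
    (γ : K) (n : ℕ) :
    coeff n ((exp K).subst (C γ * X - C γ * X ^ p : K⟦X⟧)) = dworkCoeff K p γ n := by
  have h : (C γ * X - C γ * X ^ p : K⟦X⟧) = C γ * X + expand p hp (C (-γ) * X) := by
    rw [map_mul, expand_C, expand_X, map_neg]
    ring
  rw [h, exp_subst_add (by simp) (by rw [constantCoeff_expand]; simp), ← expand_exp_subst (by simp),
    exp_subst_C_mul_X, exp_subst_C_mul_X, mul_comm, coeff_mul,
    Finset.Nat.sum_antidiagonal_eq_sum_range_succ_mk, dworkCoeff]
  refine (Finset.sum_of_injOn (fun j => p * j) ?_ ?_ ?_ ?_).symm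
  · intro i _ j _ hij
    exact Nat.eq_of_mul_eq_mul_left (Nat.pos_of_ne_zero hp) hij
  · intro j hj
    have hj' : j ≤ n / p := by simpa [Nat.lt_succ_iff] using hj
    have := (Nat.le_div_iff_mul_le (Nat.pos_of_ne_zero hp)).1 hj'
    simp only [Finset.coe_range, Set.mem_Iio]
    rw [mul_comm p j]
    omega
  · intro i hi hi'
    rw [coeff_expand_of_not_dvd, zero_mul]
    rintro ⟨j, rfl⟩
    refine hi' ⟨j, ?_, rfl⟩
    have : p * j ≤ n := by simpa [Nat.lt_succ_iff] using hi
    simpa [Nat.lt_succ_iff, Nat.le_div_iff_mul_le (Nat.pos_of_ne_zero hp), mul_comm] using this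
  · intro j _
    rw [coeff_expand_mul, coeff_rescale, coeff_rescale, coeff_exp, coeff_exp]
    simp only [map_div₀, map_one, map_natCast]
    ring

section UltrametricBounds

variable {L : Type*} [NormedField L] [IsUltrametricDist L]

theorem PowerSeries.norm_coeff_mul_le_of_le {f g : L⟦X⟧} {A B r : ℝ} (hA : 0 ≤ A)
    (hB : 0 ≤ B) (hr : 0 ≤ r) (hf : ∀ n, ‖coeff n f‖ ≤ A * r ^ n)
    (hg : ∀ n, ‖coeff n g‖ ≤ B * r ^ n) (n : ℕ) : ‖coeff n (f * g)‖ ≤ A * B * r ^ n := by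
  rw [coeff_mul]
  refine IsUltrametricDist.norm_sum_le_of_forall_le_of_nonneg (by positivity) fun x hx => ?_
  rw [norm_mul, ← Finset.HasAntidiagonal.mem_antidiagonal.1 hx, pow_add]
  calc _ ≤ (A * r ^ x.1) * (B * r ^ x.2) :=
        mul_le_mul (hf _) (hg _) (norm_nonneg _) (by positivity)
    _ = _ := by ring

theorem PowerSeries.norm_coeff_pow_le_of_le {f : L⟦X⟧} {A r : ℝ} (hA : 0 ≤ A)
    (hr : 0 ≤ r) (hf : ∀ n, ‖coeff n f‖ ≤ A * r ^ n) (d n : ℕ) :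
    ‖coeff n (f ^ d)‖ ≤ A ^ d * r ^ n := by
  induction d generalizing n with
  | zero =>
    rw [pow_zero, pow_zero, coeff_one]
    split_ifs with h
    · simp [h]
    · simpa using pow_nonneg hr n
  | succ d ih =>
    rw [pow_succ, pow_succ]
    exact norm_coeff_mul_le_of_le (by positivity) hA hr ih hf n

/-- If `c ^ d ≤ ‖d!‖` for all `d`, then `exp f` has coefficients of norm at most `r ^ n` as soon
as those of `f` have norm at most `c * r ^ n`. -/
theorem PowerSeries.norm_coeff_exp_subst_le [CharZero L] {f : L⟦X⟧} {c r : ℝ} (hc : 0 < c)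
    (hr : 0 ≤ r) (hfact : ∀ d : ℕ, c ^ d ≤ ‖(d.factorial : L)‖) (hf0 : constantCoeff f = 0)
    (hf : ∀ n, ‖coeff n f‖ ≤ c * r ^ n) (n : ℕ) :
    ‖coeff n ((exp L).subst f)‖ ≤ r ^ n := by
  rw [coeff_subst' (HasSubst.of_constantCoeff_zero' hf0)]
  refine finsum_induction (fun x : L => ‖x‖ ≤ r ^ n) (by simpa using pow_nonneg hr n)
    (fun x y hx hy => (IsUltrametricDist.norm_add_le_max x y).trans (max_le hx hy)) fun d => ?_
  have hd : 0 < ‖(d.factorial : L)‖ := (pow_pos hc d).trans_le (hfact d)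
  rw [smul_eq_mul, norm_mul, coeff_exp, map_div₀, map_one, map_natCast, norm_div, norm_one,
    one_div_mul_eq_div, div_le_iff₀ hd]
  calc _ ≤ c ^ d * r ^ n := norm_coeff_pow_le_of_le hc.le hr hf d n
    _ ≤ ‖(d.factorial : L)‖ * r ^ n := by gcongr; exact hfact d
    _ = _ := mul_comm _ _

end UltrametricBounds

theorem PadicInt.norm_coeff_pow_sub_expand_le {p : ℕ} [hp : Fact p.Prime]
    (h : Polynomial ℤ_[p]) (n : ℕ) :
    ‖(h ^ p - Polynomial.expand ℤ_[p] p h).coeff n‖ ≤ (p : ℝ)⁻¹ := by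
  have h0 : (h ^ p - Polynomial.expand ℤ_[p] p h).map PadicInt.toZMod = 0 := by
    rw [Polynomial.map_sub, Polynomial.map_pow, Polynomial.map_expand, ZMod.expand_card, sub_self]
  have h1 := congrArg (Polynomial.coeff · n) h0
  simp only [Polynomial.coeff_map, Polynomial.coeff_zero] at h1
  rw [← RingHom.mem_ker, PadicInt.ker_toZMod, PadicInt.maximalIdeal_eq_span_p,
    ← pow_one (p : ℤ_[p]), ← PadicInt.norm_le_pow_iff_mem_span_pow] at h1
  simpa using h1

/-- **Dwork's lemma**: a power series `f` with constant coefficient `1` such that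
`f(X) ^ p / f(X ^ p)` is congruent to `1` modulo `p` has `p`-integral coefficients. -/
theorem PowerSeries.norm_coeff_le_one_of_pow_eq_expand_mul {p : ℕ} [hp : Fact p.Prime]
    {f g : ℚ_[p]⟦X⟧} (hf : constantCoeff f = 1) (hg : constantCoeff g = 1)
    (hgn : ∀ n ≠ 0, ‖coeff n g‖ ≤ (p : ℝ)⁻¹) (hfg : f ^ p = expand p hp.out.ne_zero f * g)
    (n : ℕ) : ‖coeff n f‖ ≤ 1 := by
  have hp0 : (0 : ℝ) < p := by exact_mod_cast hp.out.pos
  induction n using Nat.strong_induction_on with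
  | _ n ih =>
    rcases Nat.eq_zero_or_pos n with rfl | hn
    · simp [hf]
    let u : ℕ → ℤ_[p] := fun i => if h : ‖coeff i f‖ ≤ 1 then ⟨coeff i f, h⟩ else 0
    have hu : ∀ i < n, ((u i : ℤ_[p]) : ℚ_[p]) = coeff i f := fun i hi => by
      simp [u, ih i hi]
    let h : Polynomial ℤ_[p] := trunc n (PowerSeries.mk u)
    let φ : ℤ_[p] →+* ℚ_[p] := PadicInt.Coe.ringHom
    have hh : ∀ i, coeff i (h.map φ : ℚ_[p]⟦X⟧) = if i < n then coeff i f else 0 := fun i => by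
      rw [Polynomial.coeff_coe, Polynomial.coeff_map, coeff_trunc, coeff_mk]
      split_ifs with hi
      · exact hu i hi
      · simp
    obtain ⟨q, hq⟩ : (X : ℚ_[p]⟦X⟧) ^ n ∣ f - (h.map φ : ℚ_[p]⟦X⟧) := by
      rw [X_pow_dvd_iff]
      intro m hm
      rw [map_sub, hh, if_pos hm, sub_self]
    have hq0 : constantCoeff q = coeff n f := by
      have := congrArg (coeff n) hq
      rw [map_sub, hh, if_neg (lt_irrefl n), sub_zero, coeff_X_pow_mul', if_pos le_rfl,
        Nat.sub_self, coeff_zero_eq_constantCoeff_apply] at this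
      exact this.symm
    have hh0 : constantCoeff (h.map φ : ℚ_[p]⟦X⟧) = 1 := by
      rw [← coeff_zero_eq_constantCoeff_apply, hh, if_pos hn, coeff_zero_eq_constantCoeff_apply, hf]
    obtain ⟨k, hk⟩ := Polynomial.powAddExpansion (h.map φ : ℚ_[p]⟦X⟧) (X ^ n * q) p
    rw [← hq, add_sub_cancel, hq] at hk
    have hpow : coeff n (f ^ p) = φ ((h ^ p).coeff n) + p * coeff n f := by
      have h1 : (p : ℚ_[p]⟦X⟧) * (h.map φ : ℚ_[p]⟦X⟧) ^ (p - 1) * (X ^ n * q) =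
          X ^ n * (C (p : ℚ_[p]) * (h.map φ : ℚ_[p]⟦X⟧) ^ (p - 1) * q) := by
        rw [map_natCast]; ring
      have h2 : k * (X ^ n * q) ^ 2 = X ^ n * (X ^ n * (k * q ^ 2)) := by ring
      rw [hk, map_add, map_add, h1, h2, coeff_X_pow_mul', coeff_X_pow_mul', if_pos le_rfl,
        if_pos le_rfl, Nat.sub_self, coeff_zero_eq_constantCoeff_apply,
        coeff_zero_eq_constantCoeff_apply, ← Polynomial.coe_pow, Polynomial.coeff_coe,
        ← Polynomial.map_pow, Polynomial.coeff_map]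
      simp only [map_mul, map_pow, hh0, hq0, constantCoeff_C, constantCoeff_X]
      simp [hn.ne']
    have hexp : ∀ i ≤ n, coeff i (expand p hp.out.ne_zero f) =
        φ ((Polynomial.expand ℤ_[p] p h).coeff i) := by
      intro i hi
      rw [coeff_expand, Polynomial.coeff_expand hp.out.pos]
      split_ifs with hpi
      · rw [← Polynomial.coeff_map, ← Polynomial.coeff_coe, hh, if_pos]
        rcases Nat.eq_zero_or_pos i with rfl | hi0
        · simpa using hn
        · exact (Nat.div_lt_self hi0 hp.out.one_lt).trans_le hi
      · simp
    have hmul : ‖coeff n (expand p hp.out.ne_zero f * g) -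
        φ ((Polynomial.expand ℤ_[p] p h).coeff n)‖ ≤ (p : ℝ)⁻¹ := by
      have : expand p hp.out.ne_zero f * g =
          expand p hp.out.ne_zero f + expand p hp.out.ne_zero f * (g - 1) := by ring
      rw [this, map_add, hexp n le_rfl, add_sub_cancel_left, coeff_mul]
      refine IsUltrametricDist.norm_sum_le_of_forall_le_of_nonneg (by positivity) fun x hx => ?_
      have hx' := Finset.HasAntidiagonal.mem_antidiagonal.1 hx
      rw [hexp x.1 (by omega), norm_mul]
      have h2 : ‖coeff x.2 (g - 1)‖ ≤ (p : ℝ)⁻¹ := by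
        rcases eq_or_ne x.2 0 with h0 | h0
        · rw [h0, coeff_zero_eq_constantCoeff_apply, map_sub, hg, map_one, sub_self, norm_zero]
          positivity
        · rw [map_sub, coeff_one, if_neg h0, sub_zero]
          exact hgn _ h0
      exact (mul_le_of_le_one_left (norm_nonneg _) (PadicInt.norm_le_one _)).trans h2
    have hkey : (p : ℚ_[p]) * coeff n f = (coeff n (expand p hp.out.ne_zero f * g) -
        φ ((Polynomial.expand ℤ_[p] p h).coeff n)) -
        φ ((h ^ p - Polynomial.expand ℤ_[p] p h).coeff n) := by
      rw [← hfg, hpow, Polynomial.coeff_sub, map_sub]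
      ring
    have hle : ‖(p : ℚ_[p]) * coeff n f‖ ≤ (p : ℝ)⁻¹ := by
      rw [hkey, sub_eq_add_neg]
      refine (IsUltrametricDist.norm_add_le_max _ _).trans ?_
      rw [norm_neg]
      exact max_le hmul (PadicInt.norm_coeff_pow_sub_expand_le h n)
    rw [norm_mul, Padic.norm_p] at hle
    exact (mul_le_iff_le_one_right (inv_pos.2 hp0)).1 hle

open Classical in
/-- The series `∑ i, X ^ (p ^ i) / p ^ i`, whose exponential is the Artin–Hasse exponential. -/
noncomputable def artinHasseLog (K : Type*) [Field K] (p : ℕ) : K⟦X⟧ :=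
  PowerSeries.mk fun n => if ∃ i, n = p ^ i then (n : K)⁻¹ else 0

theorem constantCoeff_artinHasseLog (K : Type*) [Field K] (p : ℕ) :
    constantCoeff (artinHasseLog K p) = 0 := by
  rw [← coeff_zero_eq_constantCoeff_apply, artinHasseLog, coeff_mk]
  simp

theorem coeff_pow_artinHasseLog (K : Type*) [Field K] (p i : ℕ) :
    coeff (p ^ i) (artinHasseLog K p) = ((p : K) ^ i)⁻¹ := by
  rw [artinHasseLog, coeff_mk, if_pos ⟨i, rfl⟩, Nat.cast_pow]

theorem coeff_artinHasseLog_of_forall_ne (K : Type*) [Field K] {p n : ℕ}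
    (h : ∀ i, n ≠ p ^ i) : coeff n (artinHasseLog K p) = 0 := by
  rw [artinHasseLog, coeff_mk, if_neg]
  rintro ⟨i, hi⟩
  exact h i hi

theorem nsmul_artinHasseLog (K : Type*) [Field K] [CharZero K] {p : ℕ} (hp : p.Prime) :
    p • artinHasseLog K p = C (p : K) * X + expand p hp.ne_zero (artinHasseLog K p) := by
  have hp0 : (p : K) ≠ 0 := by exact_mod_cast hp.ne_zero
  ext n
  rw [map_nsmul, map_add, coeff_C_mul, coeff_X, coeff_expand, nsmul_eq_mul]
  by_cases hn : ∃ i, n = p ^ i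
  · obtain ⟨i, rfl⟩ := hn
    rw [coeff_pow_artinHasseLog]
    cases i with
    | zero => simp [hp.ne_one]
    | succ i =>
      have h1 : p ^ (i + 1) ≠ 1 := (Nat.one_lt_pow i.succ_ne_zero hp.one_lt).ne'
      rw [if_neg h1, if_pos (dvd_pow_self p i.succ_ne_zero), pow_succ p,
        Nat.mul_div_cancel _ hp.pos, coeff_pow_artinHasseLog, mul_zero, zero_add, pow_succ]
      field_simp
  · push Not at hn
    rw [coeff_artinHasseLog_of_forall_ne K hn, if_neg (by simpa using hn 0)]
    split_ifs with hpn
    · obtain ⟨m, rfl⟩ := hpn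
      rw [Nat.mul_div_cancel_left _ hp.pos, coeff_artinHasseLog_of_forall_ne]
      · simp
      · rintro i rfl
        exact hn (i + 1) (pow_succ' p i).symm
    · simp

theorem Padic.norm_factorial (p : ℕ) [Fact p.Prime] (n : ℕ) :
    ‖(n.factorial : ℚ_[p])‖ = (p : ℝ)⁻¹ ^ padicValNat p n.factorial := by
  rw [Padic.norm_eq_zpow_neg_valuation (by exact_mod_cast n.factorial_ne_zero),
    Padic.valuation_natCast, zpow_neg, zpow_natCast, inv_pow]

/-- The Artin–Hasse exponential has `p`-integral coefficients. -/
theorem norm_coeff_exp_artinHasseLog_le_one (p : ℕ) [hp : Fact p.Prime] (n : ℕ) :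
    ‖coeff n ((exp ℚ_[p]).subst (artinHasseLog ℚ_[p] p))‖ ≤ 1 := by
  have hp0 : (p : ℝ) ≠ 0 := by exact_mod_cast hp.out.ne_zero
  have hp1 : (1 : ℝ) ≤ p := by exact_mod_cast hp.out.one_le
  have h0 := constantCoeff_artinHasseLog ℚ_[p] p
  refine norm_coeff_le_one_of_pow_eq_expand_mul (g := rescale (p : ℚ_[p]) (exp ℚ_[p]))
    (constantCoeff_exp_subst h0) ?_ ?_ ?_ n
  · rw [← coeff_zero_eq_constantCoeff_apply, coeff_rescale]
    simp
  · intro n hn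
    have hlt := padicValNat_factorial_lt_of_ne_zero p hn
    rw [coeff_rescale, coeff_exp, map_div₀, map_one, map_natCast, norm_mul, norm_pow, norm_div,
      norm_one, Padic.norm_p, Padic.norm_factorial, mul_one_div,
      div_le_iff₀ (by positivity), ← pow_succ']
    exact pow_le_pow_of_le_one (by positivity) (inv_le_one_of_one_le₀ hp1) hlt
  · rw [← exp_subst_nsmul h0, nsmul_artinHasseLog _ hp.out,
      exp_subst_add (by simp) (by rw [constantCoeff_expand, h0]), expand_exp_subst h0,
      exp_subst_C_mul_X, mul_comm]

theorem pow_exponent_bound {p : ℕ} (hp : 1 ≤ p) (i : ℕ) :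
    (p - 1) * (i + 2) + 1 + (p - 1) ^ 2 * p ^ i ≤ p ^ (i + 2) := by
  obtain ⟨q, rfl⟩ := Nat.exists_eq_add_of_le hp
  simp only [Nat.add_sub_cancel_left]
  induction i with
  | zero =>
    rw [pow_zero, zero_add]
    nlinarith
  | succ i ih =>
    have h1 : 1 ≤ (1 + q) ^ i := Nat.one_le_pow _ _ (by omega)
    have h2 : (1 + q) ^ (i + 2) = (1 + q) ^ i * (1 + q) ^ 2 := pow_add _ _ _
    have h3 : (1 + q) ^ (i + 1 + 2) = (1 + q) ^ (i + 2) * (1 + q) := pow_succ _ _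
    have h4 : (1 + q) ^ (i + 1) = (1 + q) ^ i * (1 + q) := pow_succ _ _
    rw [h3, h4]
    nlinarith [Nat.mul_le_mul_right (1 + q) ih, Nat.zero_le q, Nat.zero_le i,
      Nat.zero_le (q * q * (i + 2))]

section Dwork

variable {p : ℕ} [hp : Fact p.Prime] {L : Type*} [NormedField L] [Algebra ℚ_[p] L]

theorem norm_coeff_exp_artinHasseLog_le_one_of_algebra [CharZero L]
    (hnorm : ∀ q : ℚ_[p], ‖algebraMap ℚ_[p] L q‖ = ‖q‖) (n : ℕ) :
    ‖coeff n ((exp L).subst (artinHasseLog L p))‖ ≤ 1 := by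
  have h0 := constantCoeff_artinHasseLog ℚ_[p] p
  have hmap : PowerSeries.map (algebraMap ℚ_[p] L) (artinHasseLog ℚ_[p] p) =
      artinHasseLog L p := by
    ext m
    rw [coeff_map, artinHasseLog, artinHasseLog, coeff_mk, coeff_mk]
    split_ifs <;> simp
  have h1 : PowerSeries.map (algebraMap ℚ_[p] L)
      ((exp ℚ_[p]).subst (artinHasseLog ℚ_[p] p)) = (exp L).subst (artinHasseLog L p) := by
    rw [← hmap, ← map_exp (algebraMap ℚ_[p] L)]
    exact map_subst (HasSubst.of_constantCoeff_zero' h0) (exp ℚ_[p])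
  rw [← h1, coeff_map, hnorm]
  exact norm_coeff_exp_artinHasseLog_le_one p n

theorem norm_pow_eq_inv_of_pow_eq_neg (hnorm : ∀ q : ℚ_[p], ‖algebraMap ℚ_[p] L q‖ = ‖q‖)
    {γ : L} (hγ : γ ^ (p - 1) = -(p : L)) : ‖γ‖ ^ (p - 1) = (p : ℝ)⁻¹ := by
  rw [← norm_pow, hγ, norm_neg, ← map_natCast (algebraMap ℚ_[p] L), hnorm, Padic.norm_p]

theorem pow_le_norm_factorial (hnorm : ∀ q : ℚ_[p], ‖algebraMap ℚ_[p] L q‖ = ‖q‖) {c : ℝ}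
    (hc0 : 0 ≤ c) (hc1 : c ≤ 1) (hc : c ^ (p - 1) = (p : ℝ)⁻¹) (d : ℕ) :
    c ^ d ≤ ‖(d.factorial : L)‖ := by
  rw [← map_natCast (algebraMap ℚ_[p] L), hnorm, Padic.norm_factorial, ← hc, ← pow_mul]
  refine pow_le_pow_of_le_one hc0 hc1 ?_
  rw [sub_one_mul_padicValNat_factorial]
  exact Nat.sub_le _ _

theorem norm_dworkCoeff_le [IsUltrametricDist L] [CharZero L]
    (hnorm : ∀ q : ℚ_[p], ‖algebraMap ℚ_[p] L q‖ = ‖q‖) {γ : L}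
    (hγ : γ ^ (p - 1) = -(p : L)) {r : ℝ} (hr : 0 ≤ r) (hrp : r ^ p ^ 2 = (p : ℝ)⁻¹ ^ (p - 1))
    (n : ℕ) : ‖dworkCoeff L p γ n‖ ≤ r ^ n := by
  have hp1 : (1 : ℝ) ≤ p := by exact_mod_cast hp.out.one_le
  have hpL : (p : L) ≠ 0 := by exact_mod_cast hp.out.ne_zero
  have hpp : p - 1 ≠ 0 := by have := hp.out.two_le; omega
  have hc := norm_pow_eq_inv_of_pow_eq_neg hnorm hγ
  have hγp : γ ^ p = -(p : L) * γ := by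
    rw [← hγ, ← pow_succ, Nat.sub_add_cancel hp.out.one_le]
  have hγ0 : γ ≠ 0 := by
    rintro rfl
    rw [zero_pow hpp] at hγ
    exact hpL (neg_eq_zero.1 hγ.symm)
  have hc0 : 0 < ‖γ‖ := norm_pos_iff.2 hγ0
  have hc1 : ‖γ‖ ≤ 1 := by
    rw [← pow_le_one_iff_of_nonneg hc0.le hpp, hc]
    exact inv_le_one_of_one_le₀ hp1
  rw [← hc, ← pow_mul, ← sq] at hrp
  have hcr : ‖γ‖ ≤ r := by
    rw [← pow_le_pow_iff_left₀ hc0.le hr (pow_ne_zero 2 hp.out.ne_zero), hrp]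
    exact pow_le_pow_of_le_one hc0.le hc1 (Nat.pow_le_pow_left (Nat.sub_le _ _) 2)
  let S := rescale γ (artinHasseLog L p)
  have hS0 : constantCoeff S = 0 := by
    rw [← coeff_zero_eq_constantCoeff_apply, coeff_rescale, coeff_zero_eq_constantCoeff_apply,
      constantCoeff_artinHasseLog, mul_zero]
  let T := C γ * X - C γ * X ^ p - S
  have hT0 : constantCoeff T = 0 := by simp [T, hS0, hp.out.ne_zero]
  have hT (m : ℕ) : ‖coeff m T‖ ≤ ‖γ‖ * r ^ m := by
    have hnn : 0 ≤ ‖γ‖ * r ^ m := by positivity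
    have hTm : coeff m T = γ * (if m = 1 then 1 else 0) - γ * (if m = p then 1 else 0) -
        γ ^ m * coeff m (artinHasseLog L p) := by
      rw [map_sub, map_sub, coeff_C_mul, coeff_C_mul, coeff_X, coeff_X_pow, coeff_rescale]
    by_cases hm : ∃ i, m = p ^ i
    · obtain ⟨i, rfl⟩ := hm
      rw [coeff_pow_artinHasseLog] at hTm
      match i with
      | 0 =>
        have : coeff (p ^ 0) T = 0 := by simpa [hp.out.ne_one.symm] using hTm
        rw [this, norm_zero]
        exact hnn
      | 1 =>
        have : coeff (p ^ 1) T = 0 := by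
          rw [hTm, pow_one, hγp, if_neg hp.out.ne_one, if_pos rfl]
          field_simp
          ring
        rw [this, norm_zero]
        exact hnn
      | i + 2 =>
        have h1 : p ^ (i + 2) ≠ 1 := (Nat.one_lt_pow (by omega) hp.out.one_lt).ne'
        have h2 : p ^ (i + 2) ≠ p := (lt_self_pow₀ hp.out.one_lt (by omega)).ne'
        rw [hTm, if_neg h1, if_neg h2, mul_zero, sub_zero, zero_sub, norm_neg, norm_mul,
          norm_inv, norm_pow, norm_pow, ← div_eq_mul_inv]
        have hpn : ‖(p : L)‖ = ‖γ‖ ^ (p - 1) := by rw [← norm_pow, hγ, norm_neg]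
        have hri : r ^ p ^ (i + 2) = ‖γ‖ ^ ((p - 1) ^ 2 * p ^ i) := by
          rw [pow_mul, ← hrp, ← pow_mul, ← pow_add, add_comm 2 i]
        rw [hpn, ← pow_mul, hri, div_le_iff₀ (by positivity), ← pow_succ', ← pow_add]
        refine pow_le_pow_of_le_one hc0.le hc1 ?_
        have := pow_exponent_bound hp.out.one_le i
        omega
    · push Not at hm
      rw [coeff_artinHasseLog_of_forall_ne L hm, if_neg (by simpa using hm 0),
        if_neg (by simpa using hm 1)] at hTm
      rw [hTm]
      simpa using hnn
  have hST : (C γ * X - C γ * X ^ p : L⟦X⟧) = S + T := by simp [T]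
  rw [← coeff_exp_subst_eq_dworkCoeff hp.out.ne_zero, hST, exp_subst_add hS0 hT0]
  have hAH (m : ℕ) : ‖coeff m ((exp L).subst S)‖ ≤ 1 * r ^ m := by
    rw [← rescale_exp_subst (constantCoeff_artinHasseLog L p), coeff_rescale, norm_mul, norm_pow,
      one_mul]
    exact (mul_le_of_le_one_right (by positivity)
      (norm_coeff_exp_artinHasseLog_le_one_of_algebra hnorm m)).trans
      (pow_le_pow_left₀ hc0.le hcr m)
  have hET (m : ℕ) : ‖coeff m ((exp L).subst T)‖ ≤ 1 * r ^ m := by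
    rw [one_mul]
    exact norm_coeff_exp_subst_le hc0 hr (pow_le_norm_factorial hnorm hc0.le hc1 hc) hT0 hT m
  simpa using norm_coeff_mul_le_of_le zero_le_one zero_le_one hr hAH hET n

end Dwork

end PowerSeries

/-- Dwork's power series `E_γ(X) = Σ e_n Xⁿ` converges at every `a` with
`‖a‖ < p^((p−1)/p²)`; in particular it converges on the closed unit disc
`{a : ‖a‖ ≤ 1}`. -/
theorem dworkSeries_summable
    (p : ℕ) [Fact p.Prime] (L : Type*) [NormedField L] [CompleteSpace L]
    [Algebra ℚ_[p] L] (hnorm : ∀ q : ℚ_[p], ‖algebraMap ℚ_[p] L q‖ = ‖q‖)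
    (γ : L) (hγ : γ ^ (p - 1) = -(p : L)) :
    (∀ a : L, ‖a‖ < (p : ℝ) ^ (((p : ℝ) - 1) / (p : ℝ) ^ 2) →
      Summable fun n : ℕ => dworkCoeff L p γ n * a ^ n) ∧
    (∀ a : L, ‖a‖ ≤ 1 → Summable fun n : ℕ => dworkCoeff L p γ n * a ^ n) := by
  have hp : p.Prime := Fact.out
  have hp0 : (0 : ℝ) < p := by exact_mod_cast hp.pos
  have hp1 : (1 : ℝ) < p := by exact_mod_cast hp.one_lt
  have : CharZero L := charZero_of_injective_algebraMap (algebraMap ℚ_[p] L).injective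
  have : IsUltrametricDist L :=
    IsUltrametricDist.isUltrametricDist_of_forall_norm_natCast_le_one fun n => by
      rw [← map_natCast (algebraMap ℚ_[p] L), hnorm]
      exact IsUltrametricDist.norm_natCast_le_one _ n
  set R : ℝ := (p : ℝ) ^ (((p : ℝ) - 1) / (p : ℝ) ^ 2) with hR
  have hR0 : 0 < R := Real.rpow_pos_of_pos hp0 _
  have hRp : R ^ p ^ 2 = (p : ℝ) ^ (p - 1) := by
    rw [hR, ← Real.rpow_natCast, ← Real.rpow_mul hp0.le, Nat.cast_pow,
      div_mul_cancel₀ _ (by positivity), ← Real.rpow_natCast, Nat.cast_sub hp.one_le, Nat.cast_one]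
  have key (a : L) (ha : ‖a‖ < R) : Summable fun n : ℕ => dworkCoeff L p γ n * a ^ n := by
    have hlt : R⁻¹ * ‖a‖ < 1 := by rwa [inv_mul_lt_iff₀ hR0, mul_one]
    refine Summable.of_norm_bounded
      (summable_geometric_of_lt_one (by positivity) hlt) fun n => ?_
    rw [norm_mul, norm_pow, mul_pow]
    gcongr
    exact norm_dworkCoeff_le hnorm hγ (by positivity) (by rw [inv_pow, hRp, inv_pow]) n
  refine ⟨key, fun a ha => key a (ha.trans_lt ?_)⟩
  exact Real.one_lt_rpow hp1 (div_pos (by linarith) (by positivity))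
end

section
/- For every a ∈ L with ‖a‖ ≤ 1, the exponential series converges at pγa and at −pγa^p, and E_γ(a)^p = exp(pγa)·exp(−pγa^p); that is, (Σ_{n≥0} e_n aⁿ)^p = (Σ_{n≥0} (pγa)ⁿ/n!)·(Σ_{n≥0} (−pγa^p)ⁿ/n!), all three series being summable. -/
open PowerSeries in
/-- The power series `exp (a X ^ k)`. -/
noncomputable def expMonomial {K : Type*} [Field K] [CharZero K] (k : ℕ) (hk : k ≠ 0) (a : K) :
    PowerSeries K :=
  expand k hk (rescale a (exp K))

namespace expMonomial

open PowerSeries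

variable {K : Type*} [Field K] [CharZero K] {k : ℕ} (hk : k ≠ 0)

lemma coeff_mul (a : K) (n : ℕ) :
    coeff (k * n) (expMonomial k hk a) = a ^ n / (n.factorial : K) := by
  simp [expMonomial, coeff_expand_mul, coeff_rescale, coeff_exp, div_eq_mul_inv]

lemma coeff_one (a : K) (n : ℕ) :
    coeff n (expMonomial 1 one_ne_zero a) = a ^ n / (n.factorial : K) := by
  simpa using coeff_mul one_ne_zero a n

lemma coeff_of_not_dvd (a : K) {n : ℕ} (h : ¬ k ∣ n) : coeff n (expMonomial k hk a) = 0 :=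
  coeff_expand_of_not_dvd k hk _ h

lemma coeff_zero (a : K) : coeff 0 (expMonomial k hk a) = 1 := by
  simpa using coeff_mul hk a 0

lemma zero : expMonomial k hk (0 : K) = 1 := by
  simp [expMonomial]

lemma mul (a b : K) : expMonomial k hk a * expMonomial k hk b = expMonomial k hk (a + b) := by
  simp only [expMonomial, ← map_mul, exp_mul_exp_eq_exp_add]

lemma pow (a : K) (m : ℕ) : expMonomial k hk a ^ m = expMonomial k hk (m * a) := by
  simp only [expMonomial, ← map_pow, exp_pow_eq_rescale_exp, rescale_rescale]

lemma expand {m n : ℕ} (hm : m ≠ 0) (hn : n ≠ 0) (h : m * k = n) (a : K) :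
    PowerSeries.expand m hm (expMonomial k hk a) = expMonomial n hn a := by
  subst h
  exact (PowerSeries.expand_mul m hm k hk _).symm

lemma rescale_map {K' : Type*} [Field K'] [CharZero K'] (f : K →+* K') (a : K) (c : K') :
    rescale c (map f (expMonomial k hk a)) = expMonomial k hk (c ^ k * f a) := by
  ext n
  rw [coeff_rescale, coeff_map]
  by_cases h : k ∣ n
  · obtain ⟨m, rfl⟩ := h
    rw [coeff_mul, coeff_mul]
    simp [mul_pow, pow_mul, mul_div_assoc]
  · rw [coeff_of_not_dvd hk _ h, coeff_of_not_dvd hk _ h, map_zero, mul_zero]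

end expMonomial

open PowerSeries in
/-- Power series whose coefficients are bounded by a supermultiplicative weight. -/
def boundedCoeffSubring {K : Type*} [NormedField K] [IsUltrametricDist K] (w : ℕ → ℝ)
    (w_one : ∀ n, 1 ≤ w n) (w_mul : ∀ m n, w m * w n ≤ w (m + n)) :
    Subring (PowerSeries K) where
  carrier := {F | ∀ n, ‖coeff n F‖ ≤ w n}
  mul_mem' := by
    intro F G hF hG n
    have w_nonneg : ∀ n, 0 ≤ w n := fun n ↦ zero_le_one.trans (w_one n)
    rw [PowerSeries.coeff_mul]
    refine IsUltrametricDist.norm_sum_le_of_forall_le_of_nonneg (w_nonneg n) fun x hx ↦ ?_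
    rw [norm_mul, ← Finset.HasAntidiagonal.mem_antidiagonal.mp hx]
    exact (mul_le_mul (hF _) (hG _) (norm_nonneg _) (w_nonneg _)).trans (w_mul _ _)
  one_mem' := by
    intro n
    rw [PowerSeries.coeff_one]
    split_ifs
    · simpa using w_one n
    · simpa using zero_le_one.trans (w_one n)
  add_mem' := by
    intro F G hF hG n
    rw [map_add]
    exact (IsUltrametricDist.norm_add_le_max _ _).trans (max_le (hF n) (hG n))
  zero_mem' := by
    intro n
    simpa using zero_le_one.trans (w_one n)
  neg_mem' := by
    intro F hF n
    simpa using hF n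

lemma exists_sum_pow_prime_eq {R ι : Type*} [CommRing R] {p : ℕ} (hp : p.Prime) (s : Finset ι)
    (f : ι → R) : ∃ r, (∑ i ∈ s, f i) ^ p = ∑ i ∈ s, f i ^ p + p * r := by
  classical
  induction s using Finset.induction_on with
  | empty => exact ⟨0, by simp [hp.ne_zero]⟩
  | insert i s hi ih =>
    obtain ⟨r, hr⟩ := ih
    obtain ⟨r', hr'⟩ := exists_add_pow_prime_eq hp (f i) (∑ j ∈ s, f j)
    refine ⟨r + f i * (∑ j ∈ s, f j) * r', ?_⟩
    rw [Finset.sum_insert hi, Finset.sum_insert hi, hr', hr]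
    ring

open PowerSeries in
lemma coeff_add_X_pow_mul_pow {R : Type*} [CommRing R] (P G : PowerSeries R)
    (hP : constantCoeff P = 1) {n : ℕ} (hn : n ≠ 0) (m : ℕ) :
    coeff n ((P + X ^ n * G) ^ m) = coeff n (P ^ m) + m * constantCoeff G := by
  obtain ⟨k, hk⟩ := Polynomial.powAddExpansion P (X ^ n * G) m
  have h₁ : coeff n ((m : PowerSeries R) * P ^ (m - 1) * (X ^ n * G)) = m * constantCoeff G := by
    rw [show (m : PowerSeries R) * P ^ (m - 1) * (X ^ n * G) =
      X ^ n * ((m : PowerSeries R) * P ^ (m - 1) * G) by ring]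
    simpa [hP] using coeff_X_pow_mul ((m : PowerSeries R) * P ^ (m - 1) * G) n 0
  have h₂ : coeff n (k * (X ^ n * G) ^ 2) = 0 := by
    rw [show k * (X ^ n * G) ^ 2 = X ^ (2 * n) * (k * G ^ 2) by ring, coeff_X_pow_mul',
      if_neg (by omega)]
  rw [hk, map_add, map_add, h₁, h₂, add_zero]

lemma Padic.norm_sub_pow_le {p : ℕ} [Fact p.Prime] {x : ℚ_[p]} (hx : ‖x‖ ≤ 1) :
    ‖x - x ^ p‖ ≤ (p : ℝ)⁻¹ := by
  obtain ⟨x, rfl⟩ : ∃ y : ℤ_[p], (y : ℚ_[p]) = x := ⟨⟨x, hx⟩, rfl⟩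
  have h : x - x ^ p ∈ IsLocalRing.maximalIdeal ℤ_[p] := by
    rw [← PadicInt.ker_toZMod, RingHom.mem_ker, map_sub, map_pow, ZMod.pow_card, sub_self]
  rw [PadicInt.maximalIdeal_eq_span_p, ← pow_one (p : ℤ_[p]),
    ← PadicInt.norm_le_pow_iff_mem_span_pow] at h
  exact_mod_cast (by simpa using h : ‖x - x ^ p‖ ≤ (p : ℝ)⁻¹)

lemma Padic.inv_norm_factorial (p : ℕ) [Fact p.Prime] (n : ℕ) :
    ‖(n.factorial : ℚ_[p])‖⁻¹ = (p : ℝ) ^ padicValNat p n.factorial := by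
  rw [Padic.norm_eq_zpow_neg_valuation (by exact_mod_cast n.factorial_ne_zero)]
  simp

section Frobenius

open PowerSeries

variable {p : ℕ} [Fact p.Prime] {w : ℕ → ℝ}

/-- A Dieudonné–Dwork type criterion: if `F ^ p` and `F (X ^ p)` differ by a factor `1 + p h`
with `h` bounded by the weight `w`, and `w` is compatible with Frobenius, then `F` is bounded
by `w`. -/
lemma norm_coeff_le_of_pow_eq_expand_mul (hp : p ≠ 0)
    (w_one : ∀ n, 1 ≤ w n) (w_mul : ∀ m n, w m * w n ≤ w (m + n))
    (w_frob : ∀ (n : ℕ) (x : ℚ_[p]), ‖x‖ ≤ w n → ‖x - x ^ p‖ ≤ w (p * n) / p)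
    {F h : PowerSeries ℚ_[p]} (hF : constantCoeff F = 1)
    (hh : h ∈ boundedCoeffSubring w w_one w_mul)
    (hFp : F ^ p = expand p hp F * (1 + p * h)) (n : ℕ) : ‖coeff n F‖ ≤ w n := by
  have hp_pos : (0 : ℝ) < p := by exact_mod_cast Nat.pos_of_ne_zero hp
  have hp_two : 2 ≤ p := (Fact.out : p.Prime).two_le
  have w_nonneg : ∀ n, 0 ≤ w n := fun n ↦ zero_le_one.trans (w_one n)
  have w_le_add : ∀ m k, w m ≤ w (m + k) := fun m k ↦
    (le_mul_of_one_le_right (w_nonneg m) (w_one k)).trans (w_mul m k)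
  induction n using Nat.strong_induction_on with
  | _ n ih =>
  rcases eq_or_ne n 0 with rfl | hn
  · simpa [hF] using w_one 0
  have h_mem : ∀ i ∈ Finset.range n,
      monomial i (coeff i F) ∈ boundedCoeffSubring w w_one w_mul := by
    intro i hi m
    rw [coeff_monomial]
    split_ifs with him
    · exact him ▸ ih i (Finset.mem_range.mp hi)
    · simpa using w_nonneg m
  obtain ⟨r, hr⟩ := exists_sum_pow_prime_eq (Fact.out : p.Prime) (Finset.univ : Finset (Fin n))
    (fun i ↦ (⟨monomial i (coeff i F), h_mem i (Finset.mem_range.mpr i.2)⟩ :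
      boundedCoeffSubring w w_one w_mul))
  replace hr := congrArg Subtype.val hr
  simp only [AddSubmonoidClass.coe_finsetSum, Subring.coe_add, Subring.coe_mul,
    SubmonoidClass.coe_pow, Subring.coe_natCast, monomial_pow] at hr
  set P : PowerSeries ℚ_[p] := ∑ i : Fin n, monomial i (coeff i F) with hPdef
  have coeff_P : ∀ m, coeff m P = if m < n then coeff m F else 0 := by
    intro m
    rw [hPdef, Fin.sum_univ_eq_sum_range (fun i ↦ monomial i (coeff i F)), map_sum]
    simp [coeff_monomial]
  obtain ⟨G, hG⟩ : X ^ n ∣ F - P := by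
    rw [X_pow_dvd_iff]
    intro m hm
    rw [map_sub, coeff_P, if_pos hm, sub_self]
  have hFP : F = P + X ^ n * G := by rw [← hG]; ring
  have hP₀ : constantCoeff P = 1 := by
    rw [← coeff_zero_eq_constantCoeff_apply, coeff_P, if_pos (Nat.pos_of_ne_zero hn),
      coeff_zero_eq_constantCoeff_apply, hF]
  have hG₀ : constantCoeff G = coeff n F := by
    have := congrArg (coeff n) hFP
    rw [map_add, coeff_P, if_neg (lt_irrefl n), zero_add] at this
    have h_coeff := coeff_X_pow_mul G n 0
    rw [zero_add, coeff_zero_eq_constantCoeff_apply] at h_coeff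
    rw [this, h_coeff]
  have key := coeff_add_X_pow_mul_pow P G hP₀ hn p
  rw [← hFP, hG₀, hFp, hr, mul_add, mul_one, map_add, map_add] at key
  have hcast : ∀ g : PowerSeries ℚ_[p], coeff n ((p : PowerSeries ℚ_[p]) * g) = p * coeff n g := by
    intro g
    rw [← nsmul_eq_mul, map_nsmul, nsmul_eq_mul]
  rw [mul_left_comm, hcast, hcast] at key
  have h_expand : ‖coeff n (expand p hp F) -
      coeff n (∑ i : Fin n, monomial (p * i) (coeff i F ^ p))‖ ≤ w n / p := by
    rw [Fin.sum_univ_eq_sum_range (fun i ↦ monomial (p * i) (coeff i F ^ p)), map_sum]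
    simp only [coeff_monomial]
    by_cases hdvd : p ∣ n
    · obtain ⟨m, rfl⟩ := hdvd
      have hm : m < p * m := by
        have : m ≠ 0 := by rintro rfl; simp at hn
        nlinarith [Nat.pos_of_ne_zero this]
      have : ∀ i, (p * m = p * i) ↔ m = i := fun i ↦ by
        rw [Nat.mul_right_inj hp]
      simp only [this, Finset.sum_ite_eq, Finset.mem_range, if_pos hm, coeff_expand_mul]
      exact w_frob m _ (ih m hm)
    · rw [coeff_expand_of_not_dvd p hp F hdvd, Finset.sum_eq_zero, sub_zero, norm_zero]
      · exact div_nonneg (w_nonneg n) hp_pos.le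
      · intro i _
        rw [if_neg]
        rintro rfl
        exact hdvd (dvd_mul_right _ _)
  have h_mul : ‖coeff n (expand p hp F * h)‖ ≤ w n := by
    rw [coeff_mul]
    refine IsUltrametricDist.norm_sum_le_of_forall_le_of_nonneg (w_nonneg n) ?_
    rintro ⟨i, j⟩ hij
    have hij' : i + j = n := Finset.HasAntidiagonal.mem_antidiagonal.mp hij
    rw [norm_mul, ← hij']
    refine (mul_le_mul ?_ (hh j) (norm_nonneg _) (w_nonneg i)).trans (w_mul i j)
    by_cases hdvd : p ∣ i
    · obtain ⟨m, rfl⟩ := hdvd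
      dsimp only
      rw [coeff_expand_mul]
      have hm : m < n := by
        rcases Nat.eq_zero_or_pos m with rfl | hm
        · exact Nat.pos_of_ne_zero hn
        · nlinarith
      have : p * m = m + (p - 1) * m := by
        obtain ⟨c, rfl⟩ := Nat.exists_eq_add_of_le' (Nat.pos_of_ne_zero hp)
        rw [Nat.add_sub_cancel]; ring
      rw [this]
      exact (ih m hm).trans (w_le_add _ _)
    · dsimp only
      rw [coeff_expand_of_not_dvd p hp F hdvd, norm_zero]
      exact w_nonneg i
  have h_eq : (p : ℚ_[p]) * coeff n F =
      (coeff n (expand p hp F) - coeff n (∑ i : Fin n, monomial (p * i) (coeff i F ^ p)))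
        + p * (coeff n (expand p hp F * h) - coeff n (r : PowerSeries ℚ_[p])) := by
    linear_combination -key
  have h_norm : ‖(p : ℚ_[p]) * coeff n F‖ ≤ w n / p := by
    rw [h_eq]
    refine (IsUltrametricDist.norm_add_le_max _ _).trans (max_le h_expand ?_)
    rw [norm_mul, Padic.norm_p, inv_mul_eq_div]
    gcongr
    rw [sub_eq_add_neg]
    exact (IsUltrametricDist.norm_add_le_max _ _).trans
      (max_le h_mul (by simpa using r.2 n))
  rw [norm_mul, Padic.norm_p, inv_mul_eq_div] at h_norm
  exact (div_le_div_iff_of_pos_right hp_pos).mp h_norm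

end Frobenius

section Weight

lemma tsub_add_tsub_le (a b m n : ℕ) : (a * m - b) + (a * n - b) ≤ a * (m + n) - b := by
  rw [mul_add]
  omega

/-- The weight controlling the coefficients of `exp (X + X ^ p / p)`. -/
noncomputable def dworkWeight (p : ℕ) (q : ℝ) (n : ℕ) : ℝ := q ^ ((2 * p - 1) * n - p ^ 2)

variable {p : ℕ} {q : ℝ}

lemma one_le_dworkWeight (hq : 1 ≤ q) (n : ℕ) : 1 ≤ dworkWeight p q n := one_le_pow₀ hq

lemma dworkWeight_mul_le (hq : 1 ≤ q) (m n : ℕ) :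
    dworkWeight p q m * dworkWeight p q n ≤ dworkWeight p q (m + n) := by
  rw [dworkWeight, dworkWeight, dworkWeight, ← pow_add]
  exact pow_le_pow_right₀ hq (tsub_add_tsub_le _ _ _ _)

lemma norm_sub_pow_le_dworkWeight [Fact p.Prime] (hq : 1 ≤ q) (hqp : q ^ (p ^ 2 * (p - 1)) = p)
    (n : ℕ) (x : ℚ_[p]) (hx : ‖x‖ ≤ dworkWeight p q n) :
    ‖x - x ^ p‖ ≤ dworkWeight p q (p * n) / p := by
  have hp : 0 < p := (Fact.out : p.Prime).pos
  have hp' : (0 : ℝ) < p := by exact_mod_cast hp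
  rcases Nat.eq_zero_or_pos ((2 * p - 1) * n - p ^ 2) with h | h
  · rw [dworkWeight, h, pow_zero] at hx
    refine (Padic.norm_sub_pow_le hx).trans ?_
    rw [inv_eq_one_div]
    gcongr
    exact one_le_dworkWeight hq _
  · have hw : dworkWeight p q n ^ p = dworkWeight p q (p * n) / p := by
      rw [eq_div_iff hp'.ne', ← hqp, dworkWeight, dworkWeight, ← pow_mul, ← pow_add]
      congr 1
      obtain ⟨c, rfl⟩ : ∃ c, p = c + 1 := ⟨p - 1, by omega⟩
      obtain ⟨d, hd⟩ := Nat.exists_eq_add_of_lt (Nat.lt_of_sub_pos h)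
      have h₁ : (2 * (c + 1) - 1) * n - (c + 1) ^ 2 = d + 1 := by omega
      have h₂ : (2 * (c + 1) - 1) * ((c + 1) * n) = (c + 1) * ((c + 1) ^ 2 + d + 1) := by
        rw [← hd]; ring
      rw [h₁, h₂, Nat.add_sub_cancel]
      refine (Nat.sub_eq_of_eq_add ?_).symm
      ring
    have hxp : ‖x ^ p‖ ≤ dworkWeight p q n ^ p := by
      rw [norm_pow]
      gcongr
    rw [← hw, sub_eq_add_neg]
    refine (IsUltrametricDist.norm_add_le_max _ _).trans (max_le ?_ (by rwa [norm_neg]))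
    exact hx.trans (le_self_pow₀ (one_le_dworkWeight hq n) hp.ne')

end Weight

open PowerSeries in
lemma exists_eq_one_add_mul_of_norm_coeff_le {p : ℕ} [Fact p.Prime] {w : ℕ → ℝ}
    (w_one : ∀ n, 1 ≤ w n) (w_mul : ∀ m n, w m * w n ≤ w (m + n)) {F : PowerSeries ℚ_[p]}
    (hF : coeff 0 F = 1) (h : ∀ n, n ≠ 0 → ‖coeff n F‖ ≤ w n / p) :
    ∃ g ∈ boundedCoeffSubring (K := ℚ_[p]) w w_one w_mul, F = 1 + p * g := by
  have hp : (p : ℚ_[p]) ≠ 0 := by exact_mod_cast (Fact.out : p.Prime).ne_zero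
  have hp' : (0 : ℝ) < p := by exact_mod_cast (Fact.out : p.Prime).pos
  refine ⟨(p : ℚ_[p])⁻¹ • (F - 1), fun n ↦ ?_, ?_⟩
  · rw [coeff_smul, map_sub, PowerSeries.coeff_one]
    rcases eq_or_ne n 0 with rfl | hn
    · simpa [hF] using zero_le_one.trans (w_one 0)
    · rw [if_neg hn, sub_zero, norm_smul, norm_inv, Padic.norm_p, inv_inv]
      exact (le_div_iff₀' hp').mp (h n hn)
  · rw [← nsmul_eq_mul, ← Nat.cast_smul_eq_nsmul ℚ_[p], smul_smul, mul_inv_cancel₀ hp, one_smul,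
      add_sub_cancel]

section CoeffBound

open PowerSeries

variable {p : ℕ} [Fact p.Prime] {q : ℝ}

lemma norm_coeff_expMonomial_one_le (hq : 1 ≤ q) {n : ℕ} (hn : n ≠ 0) :
    ‖coeff n (expMonomial 1 one_ne_zero (p : ℚ_[p]))‖ ≤ dworkWeight p q n / p := by
  have hp' : (0 : ℝ) < p := by exact_mod_cast (Fact.out : p.Prime).pos
  have hp₁ : (1 : ℝ) ≤ p := by exact_mod_cast (Fact.out : p.Prime).one_le
  rw [expMonomial.coeff_one, norm_div, norm_pow, Padic.norm_p, div_eq_mul_inv,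
    Padic.inv_norm_factorial, inv_pow, inv_mul_eq_div, div_le_div_iff₀ (by positivity) hp',
    ← pow_succ]
  have h := sub_one_mul_padicValNat_factorial_lt_of_ne_zero p hn
  have h₁ : 1 ≤ p - 1 := Nat.le_sub_of_add_le (Fact.out : p.Prime).two_le
  calc (p : ℝ) ^ (padicValNat p n.factorial + 1) ≤ (p : ℝ) ^ n :=
        pow_le_pow_right₀ hp₁ (by nlinarith)
    _ ≤ dworkWeight p q n * (p : ℝ) ^ n :=
        le_mul_of_one_le_left (by positivity) (one_le_dworkWeight hq n)

lemma norm_coeff_expMonomial_sq_le (hq : 1 ≤ q) (hqp : q ^ (p ^ 2 * (p - 1)) = p)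
    (hp : p ^ 2 ≠ 0) {n : ℕ} (hn : n ≠ 0) :
    ‖coeff n (expMonomial (p ^ 2) hp (-(p : ℚ_[p])⁻¹))‖ ≤ dworkWeight p q n / p := by
  have hp₀ : 0 < p := (Fact.out : p.Prime).pos
  have hp' : (0 : ℝ) < p := by exact_mod_cast hp₀
  by_cases hdvd : p ^ 2 ∣ n
  · obtain ⟨m, rfl⟩ := hdvd
    have hm : m ≠ 0 := right_ne_zero_of_mul hn
    rw [expMonomial.coeff_mul, norm_div, norm_pow, norm_neg, norm_inv, Padic.norm_p, inv_inv,
      div_eq_mul_inv, Padic.inv_norm_factorial, le_div_iff₀ hp', ← pow_add, ← pow_succ]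
    nth_rw 1 [← hqp]
    rw [← pow_mul, dworkWeight]
    refine pow_le_pow_right₀ hq (Nat.le_sub_of_add_le ?_)
    have h := Nat.succ_le_of_lt (sub_one_mul_padicValNat_factorial_lt_of_ne_zero p hm)
    have hm₁ := Nat.pos_of_ne_zero hm
    obtain ⟨c, rfl⟩ := Nat.exists_eq_add_of_le' hp₀
    rw [show 2 * (c + 1) - 1 = 2 * c + 1 by omega]
    rw [Nat.add_sub_cancel] at h ⊢
    rw [Nat.succ_eq_add_one] at h
    generalize padicValNat (c + 1) m.factorial = v at h ⊢
    calc (c + 1) ^ 2 * c * (m + v + 1) + (c + 1) ^ 2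
        = (c + 1) ^ 2 * (c * m + (c * v + 1) + c) := by ring
      _ ≤ (c + 1) ^ 2 * (c * m + m + c * m) := by
          gcongr
          exact Nat.le_mul_of_pos_right c hm₁
      _ = (2 * c + 1) * ((c + 1) ^ 2 * m) := by ring
  · rw [expMonomial.coeff_of_not_dvd hp _ hdvd, norm_zero]
    exact div_nonneg (zero_le_one.trans (one_le_dworkWeight hq n)) hp'.le

/-- Coefficient bound for `exp (X + X ^ p / p)`. -/
lemma norm_coeff_expMonomial_mul_le (hq : 1 ≤ q) (hqp : q ^ (p ^ 2 * (p - 1)) = p)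
    (hp : p ≠ 0) (n : ℕ) :
    ‖coeff n (expMonomial 1 one_ne_zero 1 * expMonomial p hp (p : ℚ_[p])⁻¹)‖
      ≤ dworkWeight p q n := by
  have hp' : (p : ℚ_[p]) ≠ 0 := by exact_mod_cast hp
  obtain ⟨g₁, hg₁, h₁⟩ := exists_eq_one_add_mul_of_norm_coeff_le
    (one_le_dworkWeight (p := p) hq) (dworkWeight_mul_le hq)
    (expMonomial.coeff_zero one_ne_zero (p : ℚ_[p]))
    (fun _ ↦ norm_coeff_expMonomial_one_le hq)
  obtain ⟨g₂, hg₂, h₂⟩ := exists_eq_one_add_mul_of_norm_coeff_le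
    (one_le_dworkWeight (p := p) hq) (dworkWeight_mul_le hq)
    (expMonomial.coeff_zero (pow_ne_zero 2 hp) (-(p : ℚ_[p])⁻¹))
    (fun _ ↦ norm_coeff_expMonomial_sq_le hq hqp (pow_ne_zero 2 hp))
  refine norm_coeff_le_of_pow_eq_expand_mul hp (one_le_dworkWeight (p := p) hq)
    (dworkWeight_mul_le hq) (norm_sub_pow_le_dworkWeight hq hqp)
    (h := g₁ + g₂ + p * g₁ * g₂) ?_ ?_ ?_ n
  · rw [map_mul, ← coeff_zero_eq_constantCoeff_apply, ← coeff_zero_eq_constantCoeff_apply,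
      expMonomial.coeff_zero, expMonomial.coeff_zero, one_mul]
  · exact add_mem (add_mem hg₁ hg₂) (mul_mem (mul_mem (natCast_mem _ p) hg₁) hg₂)
  · have h_one : (1 : PowerSeries ℚ_[p]) + p * (g₁ + g₂ + p * g₁ * g₂) =
        expMonomial 1 one_ne_zero (p : ℚ_[p]) *
          expMonomial (p ^ 2) (pow_ne_zero 2 hp) (-(p : ℚ_[p])⁻¹) := by
      rw [h₁, h₂]; ring
    have h_inv : expMonomial (p ^ 2) (pow_ne_zero 2 hp) (p : ℚ_[p])⁻¹ *
        expMonomial (p ^ 2) (pow_ne_zero 2 hp) (-(p : ℚ_[p])⁻¹) = 1 := by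
      rw [expMonomial.mul, add_neg_cancel, expMonomial.zero]
    rw [h_one, mul_pow, expMonomial.pow, expMonomial.pow, map_mul,
      expMonomial.expand one_ne_zero hp hp (mul_one p),
      expMonomial.expand hp hp (pow_ne_zero 2 hp) (sq p).symm, mul_one, mul_inv_cancel₀ hp']
    linear_combination -(expMonomial 1 one_ne_zero (p : ℚ_[p]) * expMonomial p hp 1) * h_inv

end CoeffBound

open PowerSeries in
lemma coeff_expMonomial_mul_eq_dworkCoeff {L : Type*} [Field L] [CharZero L] {p : ℕ} (hp : p ≠ 0)
    (γ : L) (n : ℕ) :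
    coeff n (expMonomial 1 one_ne_zero γ * expMonomial p hp (-γ)) = dworkCoeff L p γ n := by
  rw [PowerSeries.coeff_mul, dworkCoeff]
  symm
  refine Finset.sum_of_injOn (fun j ↦ (n - p * j, p * j)) ?_ ?_ ?_ ?_
  · intro i _ j _ hij
    exact Nat.eq_of_mul_eq_mul_left (Nat.pos_of_ne_zero hp) (Prod.ext_iff.mp hij).2
  · intro j hj
    have : p * j ≤ n := (Nat.mul_le_mul_left p (Finset.mem_range_succ_iff.mp hj)).trans
      (Nat.mul_div_le n p)
    exact Finset.HasAntidiagonal.mem_antidiagonal.mpr (Nat.sub_add_cancel this)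
  · rintro ⟨i, j⟩ hij hj
    have hij' : i + j = n := Finset.HasAntidiagonal.mem_antidiagonal.mp hij
    suffices h : ¬ p ∣ j by
      dsimp only
      rw [expMonomial.coeff_of_not_dvd hp _ h, mul_zero]
    rintro ⟨m, rfl⟩
    refine hj ⟨m, ?_, ?_⟩
    · rw [Finset.mem_coe, Finset.mem_range_succ_iff,
        Nat.le_div_iff_mul_le (Nat.pos_of_ne_zero hp), mul_comm]
      omega
    · exact Prod.ext (by dsimp only; omega) rfl
  · intro j _
    rw [expMonomial.coeff_one, expMonomial.coeff_mul]

section Evaluation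

open PowerSeries

variable {L : Type*} [NormedField L]

lemma hasSum_sum_antidiagonal_mul [IsUltrametricDist L] {f g : ℕ → L} {s t : L}
    (hf : HasSum f s) (hg : HasSum g t) :
    HasSum (fun n ↦ ∑ x ∈ Finset.HasAntidiagonal.antidiagonal n, f x.1 * g x.2) (s * t) := by
  have : NonarchimedeanRing L := { is_nonarchimedean := NonarchimedeanAddGroup.is_nonarchimedean }
  have h : Summable fun x : ℕ × ℕ ↦ f x.1 * g x.2 := (hf.mul_of_nonarchimedean hg).summable
  have h_eq := hf.summable.tsum_mul_tsum_eq_tsum_sum_antidiagonal hg.summable h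
  rw [hf.tsum_eq, hg.tsum_eq] at h_eq
  rw [h_eq]
  exact (summable_sum_mul_antidiagonal_of_summable_mul h).hasSum

lemma hasSum_coeff_mul [IsUltrametricDist L] {F G : PowerSeries L} {a s t : L}
    (hF : HasSum (fun n ↦ coeff n F * a ^ n) s) (hG : HasSum (fun n ↦ coeff n G * a ^ n) t) :
    HasSum (fun n ↦ coeff n (F * G) * a ^ n) (s * t) := by
  convert hasSum_sum_antidiagonal_mul hF hG using 2 with n
  rw [PowerSeries.coeff_mul, Finset.sum_mul]
  refine Finset.sum_congr rfl fun x hx ↦ ?_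
  rw [← Finset.HasAntidiagonal.mem_antidiagonal.mp hx]
  ring

lemma hasSum_coeff_pow [IsUltrametricDist L] {F : PowerSeries L} {a s : L}
    (hF : HasSum (fun n ↦ coeff n F * a ^ n) s) (m : ℕ) :
    HasSum (fun n ↦ coeff n (F ^ m) * a ^ n) (s ^ m) := by
  induction m with
  | zero =>
    simp only [pow_zero, PowerSeries.coeff_one]
    convert hasSum_ite_eq 0 (1 : L) using 2 with n
    split_ifs with h <;> simp [h]
  | succ m ih =>
    rw [pow_succ, pow_succ]
    exact hasSum_coeff_mul ih hF

lemma hasSum_coeff_expMonomial [CharZero L] {k : ℕ} (hk : k ≠ 0) {a b s : L}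
    (h : HasSum (fun n : ℕ ↦ (b * a ^ k) ^ n / (n.factorial : L)) s) :
    HasSum (fun n ↦ coeff n (expMonomial k hk b) * a ^ n) s := by
  refine ((mul_right_injective₀ hk).hasSum_iff fun n hn ↦ ?_).mp ?_
  · rw [expMonomial.coeff_of_not_dvd hk _ fun ⟨m, hm⟩ ↦ hn ⟨m, hm.symm⟩, zero_mul]
  · convert h using 2 with n
    dsimp only [Function.comp]
    rw [expMonomial.coeff_mul, mul_pow, pow_mul, div_mul_eq_mul_div]

lemma summable_of_norm_le_geometric [IsUltrametricDist L] [CompleteSpace L] {f : ℕ → L} {r : ℝ}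
    (hr₀ : 0 ≤ r) (hr₁ : r < 1) (hf : ∀ n, ‖f n‖ ≤ r ^ n) : Summable f := by
  refine NonarchimedeanAddGroup.summable_of_tendsto_cofinite_zero ?_
  rw [Nat.cofinite_eq_atTop]
  exact squeeze_zero_norm hf (tendsto_pow_atTop_nhds_zero_of_lt_one hr₀ hr₁)

end Evaluation

section PadicAlgebra

open PowerSeries

variable {p : ℕ} [Fact p.Prime] {L : Type*} [NormedField L] [Algebra ℚ_[p] L]
  {γ : L}

lemma norm_natCast_of_norm_algebraMap
    (hnorm : ∀ q : ℚ_[p], ‖algebraMap ℚ_[p] L q‖ = ‖q‖) (n : ℕ) :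
    ‖(n : L)‖ = ‖(n : ℚ_[p])‖ := by
  rw [← hnorm, map_natCast]

lemma norm_pow_sub_one_eq_inv (hnorm : ∀ q : ℚ_[p], ‖algebraMap ℚ_[p] L q‖ = ‖q‖)
    (hγ : γ ^ (p - 1) = -(p : L)) : ‖γ‖ ^ (p - 1) = (p : ℝ)⁻¹ := by
  rw [← norm_pow, hγ, norm_neg, norm_natCast_of_norm_algebraMap hnorm, Padic.norm_p]

lemma norm_pow_div_factorial_le_one (hnorm : ∀ q : ℚ_[p], ‖algebraMap ℚ_[p] L q‖ = ‖q‖)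
    (hγ : γ ^ (p - 1) = -(p : L)) (n : ℕ) : ‖γ ^ n / (n.factorial : L)‖ ≤ 1 := by
  have hp : p - 1 ≠ 0 := Nat.sub_ne_zero_of_lt (Fact.out : p.Prime).one_lt
  have hp' : (0 : ℝ) < p := by exact_mod_cast (Fact.out : p.Prime).pos
  have hp₁ : (1 : ℝ) ≤ p := by exact_mod_cast (Fact.out : p.Prime).one_le
  rw [← pow_le_one_iff_of_nonneg (norm_nonneg _) hp, norm_div, norm_pow, div_pow, ← pow_mul,
    mul_comm n, pow_mul, norm_pow_sub_one_eq_inv hnorm hγ,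
    norm_natCast_of_norm_algebraMap hnorm, div_eq_mul_inv, ← inv_pow ‖_‖,
    Padic.inv_norm_factorial, inv_pow, inv_mul_eq_div, div_le_one (by positivity), ← pow_mul]
  refine pow_le_pow_right₀ hp₁ ?_
  rw [mul_comm, sub_one_mul_padicValNat_factorial]
  exact Nat.sub_le _ _

lemma summable_pow_div_factorial [IsUltrametricDist L] [CompleteSpace L]
    (hnorm : ∀ q : ℚ_[p], ‖algebraMap ℚ_[p] L q‖ = ‖q‖)
    (hγ : γ ^ (p - 1) = -(p : L)) {b : L} (hb : ‖b‖ ≤ 1) :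
    Summable fun n : ℕ ↦ ((p : L) * γ * b) ^ n / (n.factorial : L) := by
  refine summable_of_norm_le_geometric (r := (p : ℝ)⁻¹) (by positivity)
    (inv_lt_one_of_one_lt₀ (by exact_mod_cast (Fact.out : p.Prime).one_lt)) fun n ↦ ?_
  rw [show ((p : L) * γ * b) ^ n / (n.factorial : L) =
    (p : L) ^ n * (γ ^ n / (n.factorial : L)) * b ^ n by ring, norm_mul, norm_mul, norm_pow,
    norm_pow, norm_natCast_of_norm_algebraMap hnorm, Padic.norm_p, mul_assoc]
  refine mul_le_of_le_one_right (by positivity) ?_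
  exact mul_le_one₀ (norm_pow_div_factorial_le_one hnorm hγ n) (by positivity)
    (pow_le_one₀ (norm_nonneg b) hb)

lemma rescale_map_expMonomial_mul [CharZero L] (hp : p ≠ 0) (hγ : γ ^ (p - 1) = -(p : L)) :
    rescale γ (map (algebraMap ℚ_[p] L)
      (expMonomial 1 one_ne_zero 1 * expMonomial p hp (p : ℚ_[p])⁻¹)) =
    expMonomial 1 one_ne_zero γ * expMonomial p hp (-γ) := by
  have hp' : (p : L) ≠ 0 := by exact_mod_cast hp
  have hγp : γ ^ p * (p : L)⁻¹ = -γ := by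
    rw [← mul_pow_sub_one hp γ, hγ]
    field_simp
  rw [map_mul, map_mul, expMonomial.rescale_map, expMonomial.rescale_map, map_one, map_inv₀,
    map_natCast, pow_one, mul_one, hγp]

lemma exists_norm_dworkCoeff_le [CharZero L]
    (hnorm : ∀ q : ℚ_[p], ‖algebraMap ℚ_[p] L q‖ = ‖q‖) (hγ : γ ^ (p - 1) = -(p : L)) :
    ∃ r : ℝ, 0 ≤ r ∧ r < 1 ∧ ∀ n, ‖dworkCoeff L p γ n‖ ≤ r ^ n := by
  have hp : p ≠ 0 := (Fact.out : p.Prime).ne_zero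
  have hp₁ : 1 < p := (Fact.out : p.Prime).one_lt
  have hpr : (1 : ℝ) < p := by exact_mod_cast hp₁
  have hN : p ^ 2 * (p - 1) ≠ 0 := mul_ne_zero (pow_ne_zero 2 hp) (Nat.sub_ne_zero_of_lt hp₁)
  obtain ⟨q, hq₀, hqp⟩ : ∃ q : ℝ, 0 ≤ q ∧ q ^ (p ^ 2 * (p - 1)) = p :=
    ⟨(p : ℝ) ^ (((p ^ 2 * (p - 1) : ℕ) : ℝ)⁻¹), by positivity,
      Real.rpow_inv_natCast_pow (by positivity) hN⟩
  have hq : 1 < q := by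
    rw [← one_lt_pow_iff_of_nonneg hq₀ hN, hqp]
    exact hpr
  have hγq : ‖γ‖ * q ^ p ^ 2 = 1 := by
    rw [← pow_eq_one_iff_of_nonneg (by positivity) (Nat.sub_ne_zero_of_lt hp₁), mul_pow,
      norm_pow_sub_one_eq_inv hnorm hγ, ← pow_mul, hqp, inv_mul_cancel₀ (by positivity)]
  refine ⟨‖γ‖ * q ^ (2 * p - 1), by positivity, ?_, fun n ↦ ?_⟩
  · rw [← hγq]
    have hγ₀ : 0 < ‖γ‖ := (norm_nonneg γ).lt_of_ne fun h ↦ by simp [← h] at hγq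
    refine mul_lt_mul_of_pos_left (pow_lt_pow_right₀ hq ?_) hγ₀
    obtain ⟨c, rfl⟩ : ∃ c, p = c + 2 := ⟨p - 2, by omega⟩
    rw [show 2 * (c + 2) - 1 = 2 * c + 3 by omega]
    nlinarith
  · rw [← coeff_expMonomial_mul_eq_dworkCoeff hp, ← rescale_map_expMonomial_mul hp hγ,
      coeff_rescale, coeff_map, norm_mul, hnorm, norm_pow, mul_pow]
    gcongr
    refine (norm_coeff_expMonomial_mul_le hq.le hqp hp n).trans ?_
    rw [← pow_mul]
    exact pow_le_pow_right₀ hq.le (Nat.sub_le _ _)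

end PadicAlgebra

/-- For `‖a‖ ≤ 1` the exponential series converges at `pγa` and at `−pγa^p`, the Dwork
series converges at `a`, and `E_γ(a)^p = exp(pγa) · exp(−pγa^p)`. -/
theorem dworkSeries_pow_p
    (p : ℕ) [Fact p.Prime] (L : Type*) [NormedField L] [CompleteSpace L]
    [Algebra ℚ_[p] L] (hnorm : ∀ q : ℚ_[p], ‖algebraMap ℚ_[p] L q‖ = ‖q‖)
    (γ : L) (hγ : γ ^ (p - 1) = -(p : L))
    (a : L) (ha : ‖a‖ ≤ 1) :
    (Summable fun n : ℕ => ((p : L) * γ * a) ^ n / (n.factorial : L)) ∧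
    (Summable fun n : ℕ => (-((p : L) * γ * a ^ p)) ^ n / (n.factorial : L)) ∧
    (Summable fun n : ℕ => dworkCoeff L p γ n * a ^ n) ∧
    (∑' n : ℕ, dworkCoeff L p γ n * a ^ n) ^ p
      = (∑' n : ℕ, ((p : L) * γ * a) ^ n / (n.factorial : L)) *
        (∑' n : ℕ, (-((p : L) * γ * a ^ p)) ^ n / (n.factorial : L)) := by
  have hp : p ≠ 0 := (Fact.out : p.Prime).ne_zero
  have : CharZero L := charZero_of_injective_algebraMap (algebraMap ℚ_[p] L).injective
  have : IsUltrametricDist L :=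
    IsUltrametricDist.isUltrametricDist_of_forall_norm_natCast_le_one fun n ↦ by
      rw [norm_natCast_of_norm_algebraMap hnorm]
      exact IsUltrametricDist.norm_natCast_le_one ℚ_[p] n
  have h₁ := summable_pow_div_factorial hnorm hγ ha
  have h₂ : Summable fun n : ℕ => (-((p : L) * γ * a ^ p)) ^ n / (n.factorial : L) := by
    simpa only [mul_neg] using summable_pow_div_factorial hnorm hγ (b := -a ^ p)
      (by rw [norm_neg, norm_pow]; exact pow_le_one₀ (norm_nonneg a) ha)
  obtain ⟨r, hr₀, hr₁, hr⟩ := exists_norm_dworkCoeff_le hnorm hγ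
  have h₃ : Summable fun n : ℕ => dworkCoeff L p γ n * a ^ n := by
    refine summable_of_norm_le_geometric hr₀ hr₁ fun n ↦ ?_
    rw [norm_mul, norm_pow]
    exact (mul_le_of_le_one_right (norm_nonneg _) (pow_le_one₀ (norm_nonneg a) ha)).trans (hr n)
  refine ⟨h₁, h₂, h₃, ?_⟩
  have h_lhs := h₃.hasSum
  simp only [← coeff_expMonomial_mul_eq_dworkCoeff hp] at h_lhs ⊢
  have h_rhs := hasSum_coeff_mul
    (hasSum_coeff_expMonomial one_ne_zero (a := a) (b := p * γ) (by simpa using h₁.hasSum))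
    (hasSum_coeff_expMonomial hp (a := a) (b := p * -γ)
      (by simpa only [mul_neg, neg_mul] using h₂.hasSum))
  rw [← expMonomial.pow, ← expMonomial.pow, ← mul_pow] at h_rhs
  exact (hasSum_coeff_pow h_lhs p).unique h_rhs
end
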